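/- arXiv:1406.0886 — 4 statements merged into one kernel-verified Lean document; each statement's English description precedes it below -/
import Mathlib

section
/- Let A be a commutative K-algebra with indeterminates Z_{-1}, Z_{-2}, … and let Z := x + Z_{-1}x^{-1} + Z_{-2}x^{-2} + ⋯ ∈ A((x^{-1})). For all i ∈ ℕ and k, l ∈ ℤ, the partial derivative of the coefficient (Z^i)_k of x^k in Z^i with respect to Z_l equals i·(Z^{i-1})_{k-l}. -/
open Polynomial HahnSeries Finset

noncomputable section

theorem isPWO_of_bddBelow' {s : Set ℤ} (h : BddBelow s) : s.IsPWO :=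
  Set.IsWF.isPWO h.wellFoundedOn_lt

/-- The generic Laurent series `Z = x + Z₋₁x⁻¹ + Z₋₂x⁻² + ⋯` over the polynomial
algebra `A = D[Z₋₁, Z₋₂, …]`, where the `MvPolynomial` variable `v : ℕ`
represents `Z_{-(v+1)}`.  In the `t = x⁻¹` picture the coefficient of `x^k`
is the coefficient at index `-k`. -/
def genZ (D : Type*) [CommRing D] : LaurentSeries (MvPolynomial ℕ D) where
  coeff j := if j = -1 then 1 else if 1 ≤ j then MvPolynomial.X (j - 1).toNat else 0
  isPWO_support' := by
    refine isPWO_of_bddBelow' ⟨-1, ?_⟩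
    intro j hj
    by_contra h
    push_neg at h
    apply hj
    simp only [Function.mem_support]
    have h1 : ¬ (j = -1) := by omega
    have h2 : ¬ ((1 : ℤ) ≤ j) := by omega
    simp [h1, h2]

theorem dmap_mul {S R : Type*} [CommRing S] [CommRing R] [Algebra S R]
    (d : Derivation S R R) (x y : LaurentSeries R) (a : ℤ) :
    d ((x * y).coeff a) =
      (x * HahnSeries.map y d + HahnSeries.map x d * y).coeff a := by
  have hx : (HahnSeries.map x d).support ⊆ x.support := by
    intro j hj hx
    apply hj
    simp [hx]
  have hy : (HahnSeries.map y d).support ⊆ y.support := by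
    intro j hj hx
    apply hj
    simp [hx]
  rw [HahnSeries.coeff_add, HahnSeries.coeff_mul, HahnSeries.coeff_mul_left' x.isPWO_support hx,
    HahnSeries.coeff_mul_right' y.isPWO_support hy, map_sum, ← Finset.sum_add_distrib]
  refine Finset.sum_congr rfl fun ij _ => ?_
  simp [Derivation.leibniz, mul_comm]

theorem dmap_genZ (D : Type*) [CommRing D] (d : Derivation D (MvPolynomial ℕ D) (MvPolynomial ℕ D))
    (l : ℤ) (hl : l < 0) (hd : ∀ p, d p = MvPolynomial.pderiv (-l - 1).toNat p) :
    HahnSeries.map (genZ D) d = HahnSeries.single (-l) 1 := by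
  ext1
  funext j
  rw [HahnSeries.map_coeff, hd, HahnSeries.coeff_single]
  simp only [genZ]
  split_ifs with h1 h2 h3 h4 h5
  · omega
  · simp
  · subst h4; simp
  · rw [MvPolynomial.pderiv_X_of_ne]
    omega
  · omega
  · simp

theorem dmap_pow (D : Type*) [CommRing D] (d : Derivation D (MvPolynomial ℕ D) (MvPolynomial ℕ D))
    (l : ℤ) (hl : l < 0) (hd : ∀ p, d p = MvPolynomial.pderiv (-l - 1).toNat p) (n : ℕ) :
    HahnSeries.map (genZ D ^ (n + 1)) d =
      HahnSeries.single (-l) 1 * (((n + 1 : ℕ) : LaurentSeries (MvPolynomial ℕ D)) * genZ D ^ n) := by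
  induction n with
  | zero => simp [dmap_genZ D d l hl hd]
  | succ n ih =>
    have : HahnSeries.map (genZ D ^ (n + 1 + 1)) d = genZ D ^ (n + 1) * HahnSeries.map (genZ D) d
        + HahnSeries.map (genZ D ^ (n + 1)) d * genZ D := by
      ext1
      funext j
      rw [HahnSeries.map_coeff, pow_succ, dmap_mul]
    rw [this, ih, dmap_genZ D d l hl hd]
    push_cast
    ring

/-- Let `A = D[Z₋₁, Z₋₂, …]` be a polynomial algebra over a
commutative `K`-algebra `D` and `Z = x + Z₋₁x⁻¹ + Z₋₂x⁻² + ⋯ ∈ A((x⁻¹))`.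
For all `i ∈ ℕ` (`i ≥ 1`) and `k, l ∈ ℤ` with `l < 0`, the partial derivative
`∂(Z^i)_k/∂Z_l = i·(Z^{i-1})_{k-l}`, where `(·)_k` denotes the coefficient of
`x^k`, i.e. the Hahn-series coefficient at `-k`, and `Z_l` is the
`MvPolynomial` variable `(-l-1).toNat`. -/
theorem statement3 (K : Type*) [Field K] [CharZero K]
    (D : Type*) [CommRing D] [Algebra K D]
    (i : ℕ) (hi : 1 ≤ i) (k l : ℤ) (hl : l < 0) :
    MvPolynomial.pderiv (-l - 1).toNat (((genZ D) ^ i).coeff (-k)) =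
      i • (((genZ D) ^ (i - 1)).coeff (l - k)) := by
  obtain ⟨n, rfl⟩ : ∃ n, i = n + 1 := ⟨i - 1, by omega⟩
  have h := dmap_pow D (MvPolynomial.pderiv (-l - 1).toNat) l hl
    (fun _ => rfl) n
  have h2 := congrArg (fun f : LaurentSeries (MvPolynomial ℕ D) => HahnSeries.coeff f (-k)) h
  simp only [HahnSeries.map_coeff] at h2
  refine Eq.trans h2 ?_
  have e : -k = (l - k) + -l := by ring
  rw [e, HahnSeries.coeff_single_mul_add, one_mul, ← nsmul_eq_mul, HahnSeries.coeff_smul]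
  simp

end
end

section
/- Let K be a field of characteristic zero and let P = ∑_{i=0}^n p_i x^i Y^{n−i} and Q = ∑_{j=0}^m q_j x^j Y^{m−j} be homogeneous polynomials in K[x,Y] with p_n = q_m = 1. Set p := ∑ p_i x^i and q := ∑ q_j x^j in K[x]. Then the Jacobian [P,Q] := ∂_x P ∂_Y Q − ∂_Y P ∂_x Q equals λ̃ Y^{m+n−2} for some λ̃ ∈ K if and only if m p' q − n p q' = λ̃. -/
open Polynomial MvPolynomial Finset

noncomputable section

theorem aux_scale {K : Type*} [Field K] (F : MvPolynomial (Fin 2) K) (d : ℕ)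
    (hF : F.IsHomogeneous d) (c : K) (f : Fin 2 → K) :
    MvPolynomial.eval (fun i => c * f i) F = c ^ d * MvPolynomial.eval f F := by
  rw [MvPolynomial.eval_eq, MvPolynomial.eval_eq, Finset.mul_sum]
  refine Finset.sum_congr rfl fun s hs => ?_
  have h := hF (MvPolynomial.mem_support_iff.1 hs)
  have h2 : s.degree = d := by
    rw [← h, Finsupp.degree_eq_weight_one]; rfl
  have h3 : ∑ i ∈ s.support, s i = d := h2
  simp only [mul_pow, Finset.prod_mul_distrib, Finset.prod_pow_eq_pow_sum, h3]
  ring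

theorem aux_zero {K : Type*} [Field K] [CharZero K] (F : MvPolynomial (Fin 2) K) (d : ℕ)
    (hF : F.IsHomogeneous d)
    (h0 : MvPolynomial.aeval ![(Polynomial.X : Polynomial K), 1] F = 0) : F = 0 := by
  have h1 : F * MvPolynomial.X 1 = 0 := by
    apply MvPolynomial.funext
    intro f
    simp only [map_mul, MvPolynomial.eval_X, map_zero]
    by_cases hb : f 1 = 0
    · simp [hb]
    have hf : f = fun i => f 1 * (![f 0 / f 1, 1] : Fin 2 → K) i := by
      funext i
      fin_cases i
      · simp; field_simp
      · simp
    have h2 : MvPolynomial.eval ![f 0 / f 1, 1] F = 0 := by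
      have h3 := congrArg (Polynomial.aeval (f 0 / f 1)) h0
      rw [← AlgHom.comp_apply, MvPolynomial.comp_aeval, map_zero] at h3
      rw [← h3, MvPolynomial.aeval_eq_eval]
      congr 2
      funext i
      fin_cases i <;> simp
    rw [hf, aux_scale F d hF, h2]
    simp
  exact (mul_eq_zero.1 h1).resolve_right (MvPolynomial.X_ne_zero 1)

theorem aux_hom {K : Type*} [Field K] (n : ℕ) (pc : ℕ → K) :
    (∑ i ∈ Finset.range (n + 1), MvPolynomial.C (pc i) * MvPolynomial.X 0 ^ i *
      MvPolynomial.X 1 ^ (n - i) : MvPolynomial (Fin 2) K).IsHomogeneous n := by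
  apply MvPolynomial.IsHomogeneous.sum
  intro i hi
  have hi' : 0 + i + (n - i) = n := by have := Finset.mem_range.1 hi; omega
  have h := ((MvPolynomial.isHomogeneous_C (Fin 2) (pc i)).mul
    (MvPolynomial.isHomogeneous_X_pow (R := K) (0 : Fin 2) i)).mul
    (MvPolynomial.isHomogeneous_X_pow (R := K) (1 : Fin 2) (n - i))
  rwa [hi'] at h

theorem aux_dx {K : Type*} [Field K] (n : ℕ) (pc : ℕ → K) :
    MvPolynomial.aeval ![(Polynomial.X : Polynomial K), 1] (MvPolynomial.pderiv 0
      (∑ i ∈ Finset.range (n + 1), MvPolynomial.C (pc i) * MvPolynomial.X 0 ^ i *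
      MvPolynomial.X 1 ^ (n - i) : MvPolynomial (Fin 2) K)) =
    Polynomial.derivative
      (∑ i ∈ Finset.range (n + 1), Polynomial.C (pc i) * Polynomial.X ^ i) := by
  simp only [map_sum]
  refine Finset.sum_congr rfl fun i hi => ?_
  simp [Derivation.leibniz, Derivation.leibniz_pow, MvPolynomial.pderiv_X, Polynomial.derivative_X_pow]

theorem aux_dy {K : Type*} [Field K] (n : ℕ) (pc : ℕ → K) :
    MvPolynomial.aeval ![(Polynomial.X : Polynomial K), 1] (MvPolynomial.pderiv 1
      (∑ i ∈ Finset.range (n + 1), MvPolynomial.C (pc i) * MvPolynomial.X 0 ^ i *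
      MvPolynomial.X 1 ^ (n - i) : MvPolynomial (Fin 2) K)) =
    (n : Polynomial K) * (∑ i ∈ Finset.range (n + 1), Polynomial.C (pc i) * Polynomial.X ^ i) -
    Polynomial.X * Polynomial.derivative
      (∑ i ∈ Finset.range (n + 1), Polynomial.C (pc i) * Polynomial.X ^ i) := by
  simp only [map_sum, Finset.mul_sum, ← Finset.sum_sub_distrib]
  refine Finset.sum_congr rfl fun i hi => ?_
  have hi' : i ≤ n := by have := Finset.mem_range.1 hi; omega
  rcases i with _ | i
  · simp [Derivation.leibniz, Derivation.leibniz_pow, MvPolynomial.pderiv_X]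
    try ring
  · simp [Derivation.leibniz, Derivation.leibniz_pow, MvPolynomial.pderiv_X,
      Polynomial.derivative_X_pow, Nat.cast_sub hi']
    try ring

/-- Let `P = ∑ p_i x^i Y^{n−i}` and `Q = ∑ q_j x^j Y^{m−j}` be
homogeneous polynomials in `K[x,Y]` with `p_n = q_m = 1`, and let
`p = ∑ p_i x^i`, `q = ∑ q_j x^j ∈ K[x]`.  Then the Jacobian
`[P,Q] = ∂ₓP ∂_Y Q − ∂_Y P ∂ₓQ` equals `λ̃ Y^{m+n−2}` iff `m p' q − n p q' = λ̃`.
Here `x = X 0` and `Y = X 1` in `MvPolynomial (Fin 2) K`. -/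
theorem statement6 (K : Type*) [Field K] [CharZero K] (n m : ℕ)
    (hn : 1 ≤ n) (hm : 1 ≤ m) (pc qc : ℕ → K) (hpn : pc n = 1) (hqm : qc m = 1)
    (P Q : MvPolynomial (Fin 2) K)
    (hP : P = ∑ i ∈ Finset.range (n + 1),
      MvPolynomial.C (pc i) * MvPolynomial.X 0 ^ i * MvPolynomial.X 1 ^ (n - i))
    (hQ : Q = ∑ j ∈ Finset.range (m + 1),
      MvPolynomial.C (qc j) * MvPolynomial.X 0 ^ j * MvPolynomial.X 1 ^ (m - j))
    (p q : Polynomial K)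
    (hp : p = ∑ i ∈ Finset.range (n + 1), Polynomial.C (pc i) * Polynomial.X ^ i)
    (hq : q = ∑ j ∈ Finset.range (m + 1), Polynomial.C (qc j) * Polynomial.X ^ j)
    (lam : K) :
    (MvPolynomial.pderiv 0 P * MvPolynomial.pderiv 1 Q -
        MvPolynomial.pderiv 1 P * MvPolynomial.pderiv 0 Q =
          MvPolynomial.C lam * MvPolynomial.X 1 ^ (m + n - 2)) ↔
      (m : Polynomial K) * p.derivative * q - (n : Polynomial K) * p * q.derivative =
        Polynomial.C lam := by
  have hx := aux_dx n pc
  have hy := aux_dy n pc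
  have kx := aux_dx m qc
  have ky := aux_dy m qc
  have hhP := aux_hom n pc
  have hhQ := aux_hom m qc
  rw [← hP] at hx hy hhP
  rw [← hQ] at kx ky hhQ
  rw [← hp] at hx hy
  rw [← hq] at kx ky
  have key : MvPolynomial.aeval ![(Polynomial.X : Polynomial K), 1]
      (MvPolynomial.pderiv 0 P * MvPolynomial.pderiv 1 Q -
        MvPolynomial.pderiv 1 P * MvPolynomial.pderiv 0 Q) =
      (m : Polynomial K) * p.derivative * q - (n : Polynomial K) * p * q.derivative := by
    rw [map_sub, map_mul, map_mul, hx, hy, kx, ky]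
    ring
  have key2 : MvPolynomial.aeval ![(Polynomial.X : Polynomial K), 1]
      (MvPolynomial.C lam * MvPolynomial.X 1 ^ (m + n - 2) : MvPolynomial (Fin 2) K) =
      Polynomial.C lam := by
    simp
  constructor
  · intro h
    rw [← key, h, key2]
  · intro h
    rw [← sub_eq_zero]
    refine aux_zero _ (m + n - 2) ?_ ?_
    · have e1 : (n - 1) + (m - 1) = m + n - 2 := by omega
      have h1 := (hhP.pderiv (i := 0)).mul (hhQ.pderiv (i := 1))
      have h2 := (hhP.pderiv (i := 1)).mul (hhQ.pderiv (i := 0))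
      have h3 := (MvPolynomial.isHomogeneous_C (Fin 2) lam).mul
        (MvPolynomial.isHomogeneous_X_pow (R := K) (1 : Fin 2) (m + n - 2))
      rw [e1] at h1 h2
      rw [zero_add] at h3
      exact (h1.sub h2).sub h3
    · rw [map_sub, key, key2, h, sub_self]

end
end

section
/- Let K be a field of characteristic zero, d := gcd(n,m), and j ∈ ℕ_0. Let P ∈ x^j K[x] be monic of degree n, and let C = x + C_0 + C_{-1}x^{-1} + C_{-2}x^{-2} + ⋯ ∈ K((x^{-1})) satisfy C^n = P. If the coefficient (C^m)_{-k} of x^{-k} in C^m vanishes for k = 1, …, n − max(j,1), then C^d is a polynomial, i.e., C^d ∈ K[x]. -/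
open Polynomial HahnSeries Finset

noncomputable section

/-- The embedding `K[x] → K((x⁻¹))`, with the Hahn series variable `t = x⁻¹`. -/
def embX (K : Type*) [Field K] : Polynomial K →ₐ[K] LaurentSeries K :=
  Polynomial.aeval (HahnSeries.single (-1 : ℤ) (1 : K))

theorem embX_coeff {K : Type*} [Field K] (p : Polynomial K) (i : ℤ) :
    (embX K p).coeff i = if i ≤ 0 then p.coeff (-i).toNat else 0 := by
  induction p using Polynomial.induction_on' with
  | add p q hp hq =>
    rw [map_add, HahnSeries.coeff_add, hp, hq]
    split_ifs <;> simp
  | monomial k a =>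
    have h : embX K (Polynomial.monomial k a) = HahnSeries.single (-(k:ℤ)) a := by
      rw [embX, Polynomial.aeval_monomial, HahnSeries.single_pow]
      have h0 : algebraMap K (LaurentSeries K) a = HahnSeries.single 0 a := by
        rw [LaurentSeries.algebraMap_apply]
        rfl
      rw [h0]
      simp
    rw [h, HahnSeries.coeff_single, Polynomial.coeff_monomial]
    split_ifs <;> first | rfl | omega

theorem embX_inj {K : Type*} [Field K] : Function.Injective (embX K) := by
  intro p q h
  ext k
  have := congrArg (fun f => HahnSeries.coeff f (-(k:ℤ))) h
  simpa [embX_coeff] using this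

def theta {K : Type*} [Field K] (f : LaurentSeries K) : LaurentSeries K :=
  ⟨fun i => -(i:K) * f.coeff i, f.isPWO_support.mono (by
    intro i hi
    simp only [Function.mem_support, HahnSeries.mem_support] at *
    exact right_ne_zero_of_mul hi)⟩

theorem theta_coeff {K : Type*} [Field K] (f : LaurentSeries K) (i : ℤ) :
    (theta f).coeff i = -(i:K) * f.coeff i := rfl

theorem theta_support {K : Type*} [Field K] (f : LaurentSeries K) :
    (theta f).support ⊆ f.support := by
  intro i hi
  simp only [HahnSeries.mem_support, theta_coeff] at *
  exact right_ne_zero_of_mul hi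

theorem theta_add {K : Type*} [Field K] (f g : LaurentSeries K) :
    theta (f + g) = theta f + theta g := by
  ext i
  simp [theta_coeff]
  ring

theorem theta_mul {K : Type*} [Field K] (f g : LaurentSeries K) :
    theta (f * g) = theta f * g + f * theta g := by
  ext i
  rw [theta_coeff, HahnSeries.coeff_add, HahnSeries.coeff_mul,
    HahnSeries.coeff_mul_left' f.isPWO_support (theta_support f),
    HahnSeries.coeff_mul_right' g.isPWO_support (theta_support g), Finset.mul_sum,
    ← Finset.sum_add_distrib]
  refine Finset.sum_congr rfl fun x hx => ?_
  have : x.1 + x.2 = i := (Finset.mem_antidiagonal.1 hx).2.2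
  rw [theta_coeff, theta_coeff, ← this]
  push_cast
  ring

theorem theta_pow {K : Type*} [Field K] (f : LaurentSeries K) (k : ℕ) :
    theta (f ^ k) * f = k * f ^ k * theta f := by
  induction k with
  | zero =>
    have : theta (1 : LaurentSeries K) = 0 := by
      ext i
      rw [theta_coeff, HahnSeries.coeff_one]
      split_ifs with h <;> simp [h]
    simp [this]
  | succ k ih =>
    rw [pow_succ, theta_mul, add_mul, ih]
    push_cast
    ring

theorem theta_embX {K : Type*} [Field K] (p : Polynomial K) :
    theta (embX K p) = embX K (Polynomial.X * Polynomial.derivative p) := by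
  ext i
  rw [theta_coeff, embX_coeff, embX_coeff]
  split_ifs with h
  · obtain ⟨k, rfl⟩ : ∃ k : ℕ, i = -(k:ℤ) := ⟨(-i).toNat, by omega⟩
    rcases k with _ | k
    · simp
    · simp only [neg_neg, Int.toNat_natCast, Polynomial.coeff_X_mul, Polynomial.coeff_derivative]
      push_cast
      ring
  · simp

theorem low_mul {K : Type*} [Field K] (f g : LaurentSeries K) (a b : ℤ)
    (hf : ∀ i < a, f.coeff i = 0) (hg : ∀ i < b, g.coeff i = 0) :
    ∀ i < a + b, (f * g).coeff i = 0 := by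
  intro i hi
  rw [HahnSeries.coeff_mul]
  refine Finset.sum_eq_zero fun x hx => ?_
  have : x.1 + x.2 = i := (Finset.mem_antidiagonal.1 hx).2.2
  by_cases h : x.1 < a
  · rw [hf _ h, zero_mul]
  · rw [hg _ (by omega), mul_zero]

theorem lead_mul {K : Type*} [Field K] (f g : LaurentSeries K) (a b : ℤ)
    (hf : ∀ i < a, f.coeff i = 0) (hg : ∀ i < b, g.coeff i = 0) :
    (f * g).coeff (a + b) = f.coeff a * g.coeff b := by
  rw [HahnSeries.coeff_mul]
  rw [Finset.sum_eq_single (a, b)]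
  · intro x hx hne
    have : x.1 + x.2 = a + b := (Finset.mem_antidiagonal.1 hx).2.2
    by_cases h : x.1 < a
    · rw [hf _ h, zero_mul]
    · rw [hg _ (lt_of_not_ge fun h2 => hne (Prod.ext (by omega) (by omega))), mul_zero]
  · intro h
    by_contra h2
    exact h (Finset.mem_antidiagonal.2 ⟨left_ne_zero_of_mul h2, right_ne_zero_of_mul h2, rfl⟩)

theorem low_pow {K : Type*} [Field K] (f : LaurentSeries K)
    (hf : ∀ i < (-1:ℤ), f.coeff i = 0) (k : ℕ) :
    ∀ i < -(k:ℤ), (f ^ k).coeff i = 0 := by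
  induction k with
  | zero =>
    intro i hi
    rw [pow_zero, HahnSeries.coeff_one, if_neg (by simp at hi; omega)]
  | succ k ih =>
    intro i hi
    rw [pow_succ]
    exact low_mul _ _ _ _ ih hf i (by push_cast at hi; omega)

theorem key {K : Type*} [Field K] [CharZero K] (n m j : ℕ)
    (hn : 1 ≤ n)
    (P : Polynomial K) (hP : P.Monic) (hPn : P.natDegree = n)
    (hPj : Polynomial.X ^ j ∣ P)
    (C : LaurentSeries K)
    (hC1 : C.coeff (-1) = 1) (hC2 : ∀ i : ℤ, i < -1 → C.coeff i = 0)
    (hCn : C ^ n = embX K P)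
    (hvan : ∀ k : ℕ, 1 ≤ k → k ≤ n - max j 1 → (C ^ m).coeff (k : ℤ) = 0) :
    ∃ Q : Polynomial K, C ^ m = embX K Q := by
  have hC0 : C ≠ 0 := by
    rintro rfl
    simp at hC1
  have hjn : j ≤ n := by
    have := Polynomial.natDegree_le_of_dvd hPj hP.ne_zero
    simpa [hPn] using this
  set Q : Polynomial K := ∑ k ∈ Finset.range (m + 1),
    Polynomial.monomial k ((C ^ m).coeff (-(k:ℤ))) with hQ
  have hQc : ∀ k : ℕ, Q.coeff k = (C ^ m).coeff (-(k:ℤ)) := by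
    intro k
    simp only [hQ, Polynomial.finsetSum_coeff, Polynomial.coeff_monomial, Finset.sum_ite_eq',
      Finset.mem_range]
    split_ifs with h
    · rfl
    · exact (low_pow C hC2 m _ (by omega)).symm
  set F : LaurentSeries K := C ^ m - embX K Q with hF
  have hFC : C ^ m = embX K Q + F := by rw [hF]; ring
  have hFlow : ∀ i < ((n - max j 1 : ℕ) : ℤ) + 1, F.coeff i = 0 := by
    intro i hi
    rw [hF, HahnSeries.coeff_sub, embX_coeff]
    split_ifs with h
    · rw [hQc, show -(((-i).toNat : ℕ) : ℤ) = i by omega, sub_self]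
    · obtain ⟨k, rfl⟩ : ∃ k : ℕ, i = (k:ℤ) := ⟨i.toNat, by omega⟩
      rw [hvan k (by omega) (by omega), sub_zero]
  have hPlow : ∀ i < -(n:ℤ), (embX K P).coeff i = 0 := by
    rw [← hCn]
    exact low_pow C hC2 n
  have hPlead : (embX K P).coeff (-(n:ℤ)) = 1 := by
    rw [embX_coeff, if_pos (by omega), neg_neg, Int.toNat_natCast, ← hPn]
    exact hP
  have thlow : ∀ (f : LaurentSeries K) (a : ℤ), (∀ i < a, f.coeff i = 0) →
      ∀ i < a, (theta f).coeff i = 0 := by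
    intro f a h i hi
    rw [theta_coeff, h i hi, mul_zero]
  have h1 : (m : LaurentSeries K) * theta (embX K P) * C ^ m
      = n * embX K P * theta (C ^ m) := by
    rw [← hCn]
    apply mul_right_cancel₀ hC0
    linear_combination (m * C ^ m : LaurentSeries K) * theta_pow C n
      - (n * C ^ n : LaurentSeries K) * theta_pow C m
  have h2 : embX K (Polynomial.C (m:K) * (Polynomial.X * Polynomial.derivative P) * Q
      - Polynomial.C (n:K) * P * (Polynomial.X * Polynomial.derivative Q))
      = (Polynomial.C (n:K)).eval 0 • (embX K P * theta F)
        - (Polynomial.C (m:K)).eval 0 • (theta (embX K P) * F) := by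
    rw [hFC, theta_add] at h1
    rw [Polynomial.eval_C, Polynomial.eval_C, theta_embX]
    rw [theta_embX, theta_embX] at h1
    simp only [map_sub, map_mul, map_natCast] at h1 ⊢
    rw [Nat.cast_smul_eq_nsmul, Nat.cast_smul_eq_nsmul, nsmul_eq_mul, nsmul_eq_mul]
    linear_combination h1
  simp only [Polynomial.eval_C] at h2
  set S := Polynomial.C (m:K) * (Polynomial.X * Polynomial.derivative P) * Q
      - Polynomial.C (n:K) * P * (Polynomial.X * Polynomial.derivative Q) with hS
  have hSdvd : Polynomial.X ^ (max j 1) ∣ S := by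
    rcases j with _ | j
    · simp only [Nat.zero_le, max_eq_right, pow_one]
      exact ⟨Polynomial.C (m:K) * Polynomial.derivative P * Q
        - Polynomial.C (n:K) * P * Polynomial.derivative Q, by rw [hS]; ring⟩
    · rw [max_eq_left (by omega)]
      apply dvd_sub
      · apply Dvd.dvd.mul_right
        apply Dvd.dvd.mul_left
        obtain ⟨T, rfl⟩ := hPj
        refine ⟨Polynomial.C ((j:K)+1) * T + Polynomial.X * Polynomial.derivative T, ?_⟩
        simp [Polynomial.derivative_mul, Polynomial.derivative_X_pow]
        ring
      · exact Dvd.dvd.mul_right (Dvd.dvd.mul_left hPj _) _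
  have hS0 : embX K S = 0 := by
    ext i
    rw [HahnSeries.coeff_zero]
    by_cases hi : i < -(n:ℤ) + (((n - max j 1 : ℕ) : ℤ) + 1)
    · rw [h2, HahnSeries.coeff_sub, HahnSeries.coeff_smul, HahnSeries.coeff_smul,
        low_mul _ _ _ _ hPlow (thlow _ _ hFlow) i hi,
        low_mul _ _ _ _ (thlow _ _ hPlow) hFlow i hi]
      simp
    · rw [embX_coeff]
      split_ifs with h
      · exact Polynomial.X_pow_dvd_iff.1 hSdvd _ (by omega)
      · rfl
  have hF0 : F = 0 := by
    by_contra hne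
    have hk : F.coeff F.order ≠ 0 := HahnSeries.coeff_order_eq_zero.not.2 hne
    have hkl : ∀ i < F.order, F.coeff i = 0 := fun i hi => HahnSeries.coeff_eq_zero_of_lt_order hi
    have hk1 : 1 ≤ F.order := by
      by_contra h
      exact hk (hFlow _ (by omega))
    have h3 := congrArg (fun f => HahnSeries.coeff f (-(n:ℤ) + F.order)) h2
    simp only [hS0, HahnSeries.coeff_sub, HahnSeries.coeff_smul, HahnSeries.coeff_zero,
      lead_mul _ _ _ _ hPlow (thlow _ _ hkl), lead_mul _ _ _ _ (thlow _ _ hPlow) hkl,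
      theta_coeff, hPlead, smul_eq_mul] at h3
    have h4 : (((n * (F.order + m) : ℤ)) : K) * F.coeff F.order = 0 := by
      push_cast at h3 ⊢
      linear_combination h3
    rcases mul_eq_zero.1 h4 with h5 | h5
    · have h6 : (n:ℤ) * (F.order + m) = 0 := by exact_mod_cast h5
      rcases mul_eq_zero.1 h6 with h7 | h7 <;> omega
    · exact hk h5
  exact ⟨Q, by rw [hFC, hF0, add_zero]⟩

/-- Let `d := gcd(n,m)` and `j ∈ ℕ₀`.  Let `P ∈ x^j K[x]` be monic
of degree `n` and `C = x + C₀ + C₋₁x⁻¹ + ⋯ ∈ K((x⁻¹))` with `C^n = P`.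
If the coefficient of `x^{-k}` in `C^m` vanishes for `k = 1, …, n − max(j,1)`,
then `C^d ∈ K[x]`.  The coefficient of `x^k` of a Laurent series is the Hahn
series coefficient at `-k`. -/
theorem statement10 (K : Type*) [Field K] [CharZero K] (n m j : ℕ)
    (hn : 1 ≤ n) (hm : 1 ≤ m)
    (P : Polynomial K) (hP : P.Monic) (hPn : P.natDegree = n)
    (hPj : Polynomial.X ^ j ∣ P)
    (C : LaurentSeries K)
    (hC1 : C.coeff (-1) = 1) (hC2 : ∀ i : ℤ, i < -1 → C.coeff i = 0)
    (hCn : C ^ n = embX K P)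
    (hvan : ∀ k : ℕ, 1 ≤ k → k ≤ n - max j 1 → (C ^ m).coeff (k : ℤ) = 0) :
    ∃ R : Polynomial K, C ^ (Nat.gcd n m) = embX K R := by
  have hC0 : C ≠ 0 := by
    rintro rfl
    simp at hC1
  obtain ⟨Q, hQ⟩ := key n m j hn P hP hPn hPj C hC1 hC2 hCn hvan
  set a := Nat.gcdA n m with ha
  set b := Nat.gcdB n m with hb
  have hbez : Nat.gcd n m + (n * (-a).toNat + m * (-b).toNat) = n * a.toNat + m * b.toNat := by
    have h := Nat.gcd_eq_gcd_ab n m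
    have h1 : a = a.toNat - (-a).toNat := by omega
    have h2 : b = b.toNat - (-b).toNat := by omega
    rw [← ha, ← hb] at h
    zify
    linear_combination h + (n:ℤ) * h1 + (m:ℤ) * h2
  have hE : ∀ u v : ℕ, C ^ (n * u + m * v) = embX K (P ^ u * Q ^ v) := by
    intro u v
    rw [map_mul, map_pow, map_pow, ← hCn, ← hQ, ← pow_mul, ← pow_mul, ← _root_.pow_add]
  have hAB : C ^ Nat.gcd n m * embX K (P ^ (-a).toNat * Q ^ (-b).toNat)
      = embX K (P ^ a.toNat * Q ^ b.toNat) := by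
    rw [← hE, ← hE, ← _root_.pow_add, hbez]
  have hB0 : embX K (P ^ (-a).toNat * Q ^ (-b).toNat) ≠ 0 := by
    rw [← hE]
    exact pow_ne_zero _ hC0
  generalize P ^ (-a).toNat * Q ^ (-b).toNat = B at hAB hB0
  generalize P ^ a.toNat * Q ^ b.toNat = A at hAB
  obtain ⟨k, hk⟩ := Nat.gcd_dvd_left n m
  have hk0 : k ≠ 0 := by
    rintro rfl
    omega
  have hpow : A ^ k = B ^ k * P := by
    apply embX_inj
    rw [map_pow, ← hAB, mul_pow, ← pow_mul, ← hk, hCn, map_mul, map_pow, mul_comm]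
  have hd : B ∣ A := (IsIntegrallyClosed.pow_dvd_pow_iff hk0).1 ⟨P, hpow⟩
  obtain ⟨R, rfl⟩ := hd
  refine ⟨R, mul_right_cancel₀ hB0 ?_⟩
  rw [hAB, map_mul, mul_comm]

end
end

section
/- Let K be an algebraically closed field of characteristic zero and suppose m ∤ n and n ∤ m. Then for every λ ∈ K^× there exist monic polynomials p, q ∈ K[x] with deg p = n, deg q = m, the coefficient of x^{n-1} in p equal to 0, and p^m − q^n = nλ x^{mn−m−n+1} + lower order terms. -/
open Polynomial


namespace ZZ

noncomputable def NN {ι O : Type*} [DecidableEq ι] [CommRing O] (I : Finset ι) (w : ι → ℤ) (z : ι → O) : O[X] :=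
  ∑ i ∈ I, C ((w i : ℤ) : O) * ∏ j ∈ I.erase i, (X - C (z j))

noncomputable def PP {ι O : Type*} [CommRing O] (I : Finset ι) (z : ι → O) : O[X] :=
  ∏ j ∈ I, (X - C (z j))

def Pi {ι O : Type*} [CommRing O] (I : Finset ι) (w : ι → ℤ) (z : ι → O) : O :=
  ∏ i ∈ I, ∏ j ∈ I, (z i - z j) ^ ((w i).toNat * (-w j).toNat)

def TT {ι : Type*} (I : Finset ι) (w : ι → ℤ) : ℕ := ∑ i ∈ I, (w i).toNat

section basic
variable {ι O : Type*} [DecidableEq ι] [CommRing O]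

lemma NN_map {k : Type*} [CommRing k] (f : O →+* k) (I : Finset ι) (w : ι → ℤ) (z : ι → O) :
    (NN I w z).map f = NN I w (fun i => f (z i)) := by
  simp [NN, Polynomial.map_sum, Polynomial.map_prod]

lemma PP_map {k : Type*} [CommRing k] (f : O →+* k) (I : Finset ι) (z : ι → O) :
    (PP I z).map f = PP I (fun i => f (z i)) := by
  simp [PP, Polynomial.map_prod]

lemma PP_monic (I : Finset ι) (z : ι → O) : (PP I z).Monic :=
  monic_prod_of_monic _ _ (fun i _ => monic_X_sub_C _)

lemma PP_natDegree [Nontrivial O] (I : Finset ι) (z : ι → O) : (PP I z).natDegree = I.card := by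
  rw [PP, natDegree_prod_of_monic _ _ (fun i _ => monic_X_sub_C _)]
  simp

lemma PP_erase (I : Finset ι) (z : ι → O) {i : ι} (hi : i ∈ I) :
    (X - C (z i)) * PP (I.erase i) z = PP I z := by
  rw [PP, PP, Finset.mul_prod_erase I (fun j => X - C (z j)) hi]

lemma NN_union {I J : Finset ι} (h : Disjoint I J) (w : ι → ℤ) (z : ι → O) :
    NN (I ∪ J) w z = NN I w z * PP J z + NN J w z * PP I z := by
  have h1 : ∀ i ∈ I, ∏ j ∈ (I ∪ J).erase i, (X - C (z j)) =
      (∏ j ∈ I.erase i, (X - C (z j))) * PP J z := by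
    intro i hi
    have hiJ : i ∉ J := Finset.disjoint_left.mp h hi
    rw [Finset.erase_union_distrib, Finset.erase_eq_of_notMem hiJ, Finset.prod_union, PP]
    exact h.mono_left (Finset.erase_subset _ _)
  have h2 : ∀ i ∈ J, ∏ j ∈ (I ∪ J).erase i, (X - C (z j)) =
      (∏ j ∈ J.erase i, (X - C (z j))) * PP I z := by
    intro i hi
    have hiJ : i ∉ I := Finset.disjoint_right.mp h hi
    rw [Finset.erase_union_distrib, Finset.erase_eq_of_notMem hiJ, Finset.prod_union, PP, mul_comm]
    exact h.mono_right (Finset.erase_subset _ _)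
  rw [NN, Finset.sum_union h, NN, NN, Finset.sum_mul, Finset.sum_mul]
  congr 1
  · exact Finset.sum_congr rfl fun i hi => by rw [h1 i hi, mul_assoc]
  · exact Finset.sum_congr rfl fun i hi => by rw [h2 i hi, mul_assoc]

lemma NN_degree_lt [Nontrivial O] (I : Finset ι) (w : ι → ℤ) (z : ι → O) :
    (NN I w z).degree < I.card := by
  rw [NN]
  refine lt_of_le_of_lt (degree_sum_le _ _) ?_
  rw [Finset.sup_lt_iff (by exact WithBot.bot_lt_coe _)]
  intro i hi
  rw [C_mul']
  refine lt_of_le_of_lt (degree_smul_le _ _) ?_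
  have := PP_natDegree (I.erase i) z
  have h2 := (PP_monic (I.erase i) z).ne_zero
  rw [← PP, degree_eq_natDegree h2, this, Finset.card_erase_of_mem hi]
  have := Finset.card_pos.mpr ⟨i, hi⟩
  exact_mod_cast Nat.sub_lt this one_pos

lemma NN_eval (I : Finset ι) (w : ι → ℤ) (z : ι → O) {i : ι} (hi : i ∈ I) :
    (NN I w z).eval (z i) = (w i : O) * ∏ j ∈ I.erase i, (z i - z j) := by
  rw [NN, eval_finsetSum, Finset.sum_eq_single i]
  · simp [eval_prod]
  · intro j hj hji
    rw [eval_mul, eval_prod, Finset.prod_eq_zero (i := i)]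
    · simp
    · simp [hi, hji.symm]
    · simp
  · intro h; exact absurd hi h

lemma PP_coprime {I J : Finset ι} (z : ι → O) (h : ∀ i ∈ I, ∀ j ∈ J, IsUnit (z i - z j)) :
    IsCoprime (PP I z) (PP J z) := by
  apply IsCoprime.prod_left
  intro i hi
  apply IsCoprime.prod_right
  intro j hj
  exact isCoprime_X_sub_C_of_isUnit_sub (h i hi j hj)

lemma dvd_part [Nontrivial O] {I J : Finset ι} (hd : Disjoint I J) (w : ι → ℤ) (z : ι → O) (a : O)
    (h : ∀ i ∈ I, ∀ j ∈ J, IsUnit (z i - z j)) (ha : C a ∣ NN (I ∪ J) w z) :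
    C a ∣ NN I w z := by
  obtain ⟨U, V, hUV⟩ := PP_coprime z h
  obtain ⟨R, hR⟩ := ha
  have hm := PP_monic I z
  have h1 : NN I w z = (C a * (V * R)) + PP I z * (NN I w z * U - V * NN J w z) := by
    have : C a * (V * R) = V * NN (I ∪ J) w z := by rw [hR]; ring
    rw [this, NN_union hd]
    linear_combination (-NN I w z) * hUV
  have h2 : NN I w z %ₘ PP I z = NN I w z := by
    rw [modByMonic_eq_self_iff hm, degree_eq_natDegree hm.ne_zero, PP_natDegree]
    exact NN_degree_lt I w z
  rw [← h2, h1, add_modByMonic, self_mul_modByMonic hm, add_zero, C_mul', smul_modByMonic]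
  rw [← C_mul']
  exact dvd_mul_right _ _

lemma NN_comp (I : Finset ι) (w : ι → ℤ) (z ζ : ι → O) (π c : O)
    (h : ∀ i ∈ I, z i - c = π * ζ i) :
    (NN I w z).comp (C π * X + C c) = C (π ^ (I.card - 1)) * NN I w ζ := by
  rw [NN, NN, Polynomial.sum_comp, Finset.mul_sum]
  refine Finset.sum_congr rfl fun i hi => ?_
  rw [mul_comp, C_comp, prod_comp]
  have : ∀ j ∈ I.erase i, (X - C (z j)).comp (C π * X + C c) = C π * (X - C (ζ j)) := by
    intro j hj
    have := h j (Finset.mem_of_mem_erase hj)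
    have e : z j = c + π * ζ j := by rw [← this]; ring
    simp only [sub_comp, X_comp, C_comp]
    rw [e]; simp only [C_add, C_mul]; ring
  rw [Finset.prod_congr rfl this, Finset.prod_mul_distrib, Finset.prod_const,
    Finset.card_erase_of_mem hi, C_pow]
  ring

lemma TT_neg {I : Finset ι} {w : ι → ℤ} (h : ∑ i ∈ I, w i = 0) : ∑ i ∈ I, (-w i).toNat = TT I w := by
  have : (∑ i ∈ I, ((w i).toNat : ℤ)) - ∑ i ∈ I, ((-w i).toNat : ℤ) = 0 := by
    rw [← Finset.sum_sub_distrib, ← h]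
    exact Finset.sum_congr rfl fun i _ => by omega
  unfold TT
  have h2 : ((∑ i ∈ I, (w i).toNat : ℕ) : ℤ) = ((∑ i ∈ I, (-w i).toNat : ℕ) : ℤ) := by
    push_cast at this ⊢; linarith
  exact_mod_cast h2.symm

lemma Pi_scale {I : Finset ι} {w : ι → ℤ} (h : ∑ i ∈ I, w i = 0) (z ζ : ι → O) (π : O)
    (hz : ∀ i ∈ I, ∀ j ∈ I, z i - z j = π * (ζ i - ζ j)) :
    Pi I w z = π ^ (TT I w ^ 2) * Pi I w ζ := by
  have : Pi I w z = ∏ i ∈ I, ∏ j ∈ I, (π ^ ((w i).toNat * (-w j).toNat) *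
      (ζ i - ζ j) ^ ((w i).toNat * (-w j).toNat)) := by
    refine Finset.prod_congr rfl fun i hi => Finset.prod_congr rfl fun j hj => ?_
    rw [hz i hi j hj, mul_pow]
  rw [this]
  simp_rw [Finset.prod_mul_distrib]
  rw [Pi]
  congr 1
  simp_rw [Finset.prod_pow_eq_pow_sum, ← Finset.mul_sum, TT_neg h, ← Finset.sum_mul]
  rw [sq]; rfl

lemma Pi_union_dvd {I J : Finset ι} (hd : Disjoint I J) (w : ι → ℤ) (z : ι → O) :
    Pi I w z * Pi J w z ∣ Pi (I ∪ J) w z := by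
  rw [Pi, Pi, Pi, Finset.prod_union hd]
  apply mul_dvd_mul
  · apply Finset.prod_dvd_prod_of_dvd
    intro i hi
    exact Finset.prod_dvd_prod_of_subset _ _ _ Finset.subset_union_left
  · apply Finset.prod_dvd_prod_of_dvd
    intro i hi
    exact Finset.prod_dvd_prod_of_subset _ _ _ Finset.subset_union_right

lemma TT_union {I J : Finset ι} (hd : Disjoint I J) (w : ι → ℤ) :
    TT (I ∪ J) w = TT I w + TT J w := by
  rw [TT, Finset.sum_union hd]; rfl

end basic

end ZZ

namespace ZZ
section val
variable {ι O : Type*} [DecidableEq ι] [CommRing O] [IsDomain O] [ValuationRing O]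
  [CharZero (IsLocalRing.ResidueField O)]

lemma exists_min {κ : Type*} (s : Finset κ) (hs : s.Nonempty) (f : κ → O) :
    ∃ i ∈ s, ∀ j ∈ s, f i ∣ f j := by
  classical
  induction hs using Finset.Nonempty.cons_induction with
  | singleton a => exact ⟨a, by simp, by simp⟩
  | cons a s ha hs ih =>
    obtain ⟨i, hi, h⟩ := ih
    rcases ValuationRing.dvd_total (f a) (f i) with h1 | h1
    · refine ⟨a, by simp, ?_⟩
      intro j hj
      rcases Finset.mem_cons.mp hj with rfl | hj
      · exact dvd_rfl
      · exact h1.trans (h j hj)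
    · refine ⟨i, by simp [hi], ?_⟩
      intro j hj
      rcases Finset.mem_cons.mp hj with rfl | hj
      · exact h1
      · exact h j hj

lemma card_two {I : Finset ι} {w : ι → ℤ} (hw : ∀ i, w i ≠ 0) (hs : ∑ i ∈ I, w i = 0)
    (hn : I.Nonempty) : 2 ≤ I.card := by
  by_contra h
  have : I.card = 1 := by have := hn.card_pos; omega
  obtain ⟨i, rfl⟩ := Finset.card_eq_one.mp this
  exact hw i (by simpa using hs)

lemma clusterSum (w : ι → ℤ) {k : Type*} [Field k] [CharZero k] (I : Finset ι) (z : ι → k)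
    (c : k) [DecidableEq k] (h : NN I w z = 0) : ∑ i ∈ I.filter (fun i => z i = c), w i = 0 := by
  set I1 := I.filter (fun i => z i = c)
  set I2 := I.filter (fun i => ¬ z i = c)
  have hu : I1 ∪ I2 = I := Finset.filter_union_filter_not_eq _ _
  have hd : Disjoint I1 I2 := Finset.disjoint_filter_filter_not _ _ _
  rcases I1.eq_empty_or_nonempty with h0 | hne
  · simp [h0]
  rw [← hu, NN_union hd] at h
  have hP1 : PP I1 z = (X - C c) ^ I1.card := by
    rw [PP, ← Finset.prod_const]
    exact Finset.prod_congr rfl fun i hi => by rw [(Finset.mem_filter.mp hi).2]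
  have hN1 : NN I1 w z = C (((∑ i ∈ I1, w i : ℤ)) : k) * (X - C c) ^ (I1.card - 1) := by
    rw [NN]
    push_cast
    rw [map_sum, Finset.sum_mul]
    refine Finset.sum_congr rfl fun i hi => ?_
    congr 1
    rw [← Finset.card_erase_of_mem hi, ← Finset.prod_const]
    exact Finset.prod_congr rfl fun j hj => by
      rw [(Finset.mem_filter.mp (Finset.mem_of_mem_erase hj)).2]
  have hc : I1.card = (I1.card - 1) + 1 := by have := hne.card_pos; omega
  rw [hP1, hN1, hc, pow_succ] at h
  have h3 : (X - C c) ^ (I1.card - 1) *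
      (C (((∑ i ∈ I1, w i : ℤ)) : k) * PP I2 z + NN I2 w z * (X - C c)) = 0 := by
    rw [← h]; simp; ring
  have h4 := (mul_eq_zero.mp h3).resolve_left (pow_ne_zero _ (X_sub_C_ne_zero c))
  have h5 := congrArg (eval c) h4
  simp only [eval_add, eval_mul, eval_C, eval_sub, eval_X, sub_self, mul_zero, add_zero,
    eval_zero] at h5
  have h6 : (PP I2 z).eval c ≠ 0 := by
    rw [PP, eval_prod, Finset.prod_ne_zero_iff]
    intro i hi
    have := (Finset.mem_filter.mp hi).2
    simp only [eval_sub, eval_X, eval_C]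
    exact sub_ne_zero.mpr (Ne.symm this)
  exact_mod_cast (mul_eq_zero.mp h5).resolve_right h6

lemma C_dvd_map_zero {a : O} (ha : ¬ IsUnit a) {Q : O[X]} (h : C a ∣ Q) :
    Q.map (IsLocalRing.residue O) = 0 := by
  obtain ⟨R, rfl⟩ := h
  have : IsLocalRing.residue O a = 0 := by
    rw [IsLocalRing.residue_eq_zero_iff]; exact ha
  simp [this]

lemma arith (T1 T2 x y : ℕ) :
    (T1 + T2) ^ 2 * (x * y) ≤ (T1 ^ 2 * y + T2 ^ 2 * x) * (x + y) := by
  zify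
  nlinarith [sq_nonneg ((T1 : ℤ) * y - T2 * x)]

lemma lemS (w : ι → ℤ) (hw : ∀ i, w i ≠ 0) (I : Finset ι) (z : ι → O)
    (a : O) (ha : C a ∣ NN I w z) (hau : ¬ IsUnit a) (i0 j0 : ι) (hi0 : i0 ∈ I) (hj0 : j0 ∈ I)
    (hu : IsUnit (z i0 - z j0)) (hsum : ∑ i ∈ I, w i = 0)
    (IH : ∀ J : Finset ι, J ⊆ I → J.card < I.card → ∑ i ∈ J, w i = 0 → C a ∣ NN J w z →
      a ^ (TT J w ^ 2) ∣ Pi J w z ^ (J.card - 1)) :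
    a ^ (TT I w ^ 2) ∣ Pi I w z ^ (I.card - 2) := by
  classical
  set r := IsLocalRing.residue O
  have hunit : ∀ x : O, r x ≠ 0 → IsUnit x := by
    intro x hx
    by_contra h
    exact hx ((IsLocalRing.residue_eq_zero_iff x).mpr h)
  have hN0 : NN I w (fun i => r (z i)) = 0 := by
    rw [← NN_map]; exact C_dvd_map_zero hau ha
  set c := r (z i0)
  set I1 := I.filter (fun i => r (z i) = c)
  set I2 := I.filter (fun i => ¬ r (z i) = c)
  have hun : I1 ∪ I2 = I := Finset.filter_union_filter_not_eq _ _
  have hd : Disjoint I1 I2 := Finset.disjoint_filter_filter_not _ _ _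
  have hs1 : ∑ i ∈ I1, w i = 0 := clusterSum w I (fun i => r (z i)) c hN0
  have hs2 : ∑ i ∈ I2, w i = 0 := by
    rw [← hun, Finset.sum_union hd, hs1, zero_add] at hsum; exact hsum
  have hn1 : I1.Nonempty := ⟨i0, Finset.mem_filter.mpr ⟨hi0, rfl⟩⟩
  have hn2 : I2.Nonempty := by
    refine ⟨j0, Finset.mem_filter.mpr ⟨hj0, ?_⟩⟩
    intro h
    have : r (z i0 - z j0) = 0 := by rw [map_sub, h]; exact sub_self _
    exact (hu.map r).ne_zero this
  have hU : ∀ i ∈ I1, ∀ j ∈ I2, IsUnit (z i - z j) := by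
    intro i hi j hj
    apply hunit
    rw [map_sub, (Finset.mem_filter.mp hi).2]
    exact sub_ne_zero.mpr (Ne.symm (Finset.mem_filter.mp hj).2)
  have hU' : ∀ i ∈ I2, ∀ j ∈ I1, IsUnit (z i - z j) := by
    intro i hi j hj
    rw [← neg_sub]; exact (hU j hj i hi).neg
  have hcard : I1.card + I2.card = I.card := by rw [← hun, Finset.card_union_of_disjoint hd]
  have d1 : C a ∣ NN I1 w z := dvd_part hd w z a hU (by rw [hun]; exact ha)
  have d2 : C a ∣ NN I2 w z := dvd_part hd.symm w z a hU' (by rw [Finset.union_comm, hun]; exact ha)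
  have c1 := card_two hw hs1 hn1
  have c2 := card_two hw hs2 hn2
  have e1 := IH I1 (Finset.filter_subset _ _) (by omega) hs1 d1
  have e2 := IH I2 (Finset.filter_subset _ _) (by omega) hs2 d2
  obtain ⟨x, hx⟩ : ∃ x, I1.card - 1 = x := ⟨_, rfl⟩
  obtain ⟨y, hy⟩ : ∃ y, I2.card - 1 = y := ⟨_, rfl⟩
  have hxy : I.card - 2 = x + y := by omega
  have hx0 : x * y ≠ 0 := by
    apply Nat.mul_ne_zero <;> omega
  rw [hx] at e1
  rw [hy] at e2
  rw [hxy, ← hun, TT_union hd]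
  refine dvd_trans ?_ (pow_dvd_pow_of_dvd (Pi_union_dvd hd w z) _)
  rw [← IsIntegrallyClosed.pow_dvd_pow_iff hx0]
  have e3 := mul_dvd_mul (pow_dvd_pow_of_dvd e1 (y * (x + y))) (pow_dvd_pow_of_dvd e2 (x * (x + y)))
  rw [← pow_mul, ← pow_mul, ← pow_add, ← pow_mul, ← pow_mul] at e3
  rw [← pow_mul, ← pow_mul, mul_pow]
  have e4 : x * (y * (x + y)) = (x + y) * (x * y) := by ring
  have e5 : y * (x * (x + y)) = (x + y) * (x * y) := by ring
  rw [e4, e5] at e3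
  refine dvd_trans (pow_dvd_pow a ?_) e3
  have := arith (TT I1 w) (TT I2 w) x y
  calc _ ≤ _ := this
    _ = _ := by ring

lemma lemR (w : ι → ℤ) (hw : ∀ i, w i ≠ 0) : ∀ (k : ℕ) (I : Finset ι), I.card = k → ∀ (z : ι → O)
    (hz : Set.InjOn z I)
    (a : O) (ha : C a ∣ NN I w z) (hsum : ∑ i ∈ I, w i = 0),
    a ^ (TT I w ^ 2) ∣ Pi I w z ^ (I.card - 1) := by
  intro k
  induction k using Nat.strong_induction_on with
  | _ k IH =>
  intro I hk z hz a ha hsum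
  rcases I.eq_empty_or_nonempty with rfl | hne
  · simp [TT, Pi]
  have h2 := card_two hw hsum hne
  obtain ⟨q, hq, hmin⟩ := exists_min (I.offDiag)
    (by
      obtain ⟨x, hx, y, hy, hxy⟩ := Finset.one_lt_card.mp (show 1 < I.card by omega)
      exact ⟨(x, y), by simp [hx, hy, hxy]⟩) (fun q => z q.1 - z q.2)
  obtain ⟨i0, j0⟩ := q
  simp only [Finset.mem_offDiag] at hq
  obtain ⟨hi0, hj0, hij⟩ := hq
  set π := z i0 - z j0 with hπ
  have hπ0 : π ≠ 0 := fun h => hij (hz hi0 hj0 (sub_eq_zero.mp h))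
  have hdiv : ∀ i, ∃ y, i ∈ I → z i - z j0 = π * y := by
    intro i
    by_cases hi : i ∈ I
    · by_cases h : i = j0
      · exact ⟨0, fun _ => by simp [h]⟩
      · obtain ⟨y, hy⟩ := hmin (i, j0) (by simp [hi, hj0, h])
        exact ⟨y, fun _ => hy⟩
    · exact ⟨0, fun h => absurd h hi⟩
  choose ζ hζ using hdiv
  have hζd : ∀ i ∈ I, ∀ j ∈ I, z i - z j = π * (ζ i - ζ j) := by
    intro i hi j hj
    rw [mul_sub, ← hζ i hi, ← hζ j hj]; ring
  rw [Pi_scale hsum z ζ π hζd, mul_pow]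
  rcases ValuationRing.dvd_total a (π ^ (I.card - 1)) with h | h
  · apply Dvd.dvd.mul_right
    rw [← pow_mul, mul_comm, pow_mul]
    exact pow_dvd_pow_of_dvd h _
  obtain ⟨a', rfl⟩ := h
  rw [mul_pow, ← pow_mul, ← pow_mul, mul_comm (I.card - 1)]
  apply mul_dvd_mul_left
  have hcomp := NN_comp I w z ζ π (z j0) hζ
  have ha' : C a' ∣ NN I w ζ := by
    obtain ⟨R, hR⟩ := ha
    rw [hR, mul_comp, C_comp, C_mul, mul_assoc] at hcomp
    have h0 : (C (π ^ (I.card - 1)) : O[X]) ≠ 0 := by simp [hπ0]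
    exact ⟨_, (mul_left_cancel₀ h0 hcomp).symm⟩
  by_cases hau : IsUnit a'
  · exact (hau.pow _).dvd
  refine dvd_trans (lemS w hw I ζ a' ha' hau i0 j0 hi0 hj0 ?_ hsum ?_) (pow_dvd_pow _ (by omega))
  · have := hζd i0 hi0 j0 hj0
    rw [← hπ] at this
    have h1 : ζ i0 - ζ j0 = 1 := mul_left_cancel₀ hπ0 (by rw [← this, mul_one])
    rw [h1]; exact isUnit_one
  · intro J hJ hc hs hd
    refine IH J.card (by omega) J rfl ζ ?_ a' hd hs
    intro i hi j hj hij'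
    apply hz (hJ hi) (hJ hj)
    have := hζd i (hJ hi) j (hJ hj)
    rw [hij', sub_self, mul_zero] at this
    exact sub_eq_zero.mp this
end val
end ZZ

namespace ZZ
section wron

lemma wron_deg {k : Type*} [Field k] [CharZero k] {H G : k[X]} (hH : H ≠ 0) (hd : H.natDegree < G.natDegree) :
    derivative H * G - H * derivative G ≠ 0 ∧
    (derivative H * G - H * derivative G).natDegree + 1 = H.natDegree + G.natDegree := by
  have hG : G ≠ 0 := by rintro rfl; simp at hd
  set W := derivative H * G - H * derivative G with hW
  have hx : ∀ Q : k[X], (X * derivative Q).natDegree ≤ Q.natDegree ∧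
      (X * derivative Q).coeff Q.natDegree = Q.natDegree * Q.leadingCoeff := by
    intro Q
    rcases hq : Q.natDegree with _ | d
    · rw [natDegree_eq_zero] at hq
      obtain ⟨x, rfl⟩ := hq
      simp
    · constructor
      · refine natDegree_mul_le.trans ?_
        have := natDegree_derivative_le Q
        have := natDegree_X_le (R := k)
        omega
      · rw [coeff_X_mul, coeff_derivative, leadingCoeff, hq]; push_cast; ring
  have h1 : X * W = (X * derivative H) * G - H * (X * derivative G) := by rw [hW]; ring
  have h2 : (X * W).coeff (H.natDegree + G.natDegree) =
      ((H.natDegree : k) - G.natDegree) * (H.leadingCoeff * G.leadingCoeff) := by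
    rw [h1, coeff_sub, coeff_mul_add_eq_of_natDegree_le (hx H).1 le_rfl,
      coeff_mul_add_eq_of_natDegree_le le_rfl (hx G).1, (hx H).2, (hx G).2]
    simp only [leadingCoeff]; ring
  have h3 : (X * W).coeff (H.natDegree + G.natDegree) ≠ 0 := by
    rw [h2]
    refine mul_ne_zero (sub_ne_zero.mpr ?_) (mul_ne_zero (by simpa) (by simpa))
    exact_mod_cast hd.ne
  have h4 : W ≠ 0 := by intro h; rw [h] at h3; simp at h3
  refine ⟨h4, ?_⟩
  have h5 : (X * W).natDegree = H.natDegree + G.natDegree := by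
    apply le_antisymm
    · rw [h1]
      refine (natDegree_sub_le _ _).trans (max_le ?_ ?_)
      · exact natDegree_mul_le.trans (Nat.add_le_add_right (hx H).1 _)
      · exact natDegree_mul_le.trans (Nat.add_le_add_left (hx G).1 _)
    · exact le_natDegree_of_ne_zero h3
  rw [← h5, natDegree_X_mul h4]

variable {ι O : Type*} [DecidableEq ι] [CommRing O]

noncomputable def FF (I : Finset ι) (w : ι → ℤ) (z : ι → O) : O[X] :=
  ∏ i ∈ I, (X - C (z i)) ^ (w i).toNat

noncomputable def DD (I : Finset ι) (w : ι → ℤ) (z : ι → O) : O[X] :=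
  ∏ i ∈ I, (X - C (z i)) ^ ((w i).natAbs - 1)

lemma FF_map {k : Type*} [CommRing k] (f : O →+* k) (I : Finset ι) (w : ι → ℤ) (z : ι → O) :
    (FF I w z).map f = FF I w (fun i => f (z i)) := by
  simp [FF, Polynomial.map_prod]

lemma DD_map {k : Type*} [CommRing k] (f : O →+* k) (I : Finset ι) (w : ι → ℤ) (z : ι → O) :
    (DD I w z).map f = DD I w (fun i => f (z i)) := by
  simp [DD, Polynomial.map_prod]

lemma FF_monic (I : Finset ι) (w : ι → ℤ) (z : ι → O) : (FF I w z).Monic :=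
  monic_prod_of_monic _ _ (fun i _ => (monic_X_sub_C _).pow _)

lemma DD_monic (I : Finset ι) (w : ι → ℤ) (z : ι → O) : (DD I w z).Monic :=
  monic_prod_of_monic _ _ (fun i _ => (monic_X_sub_C _).pow _)

lemma FF_natDegree [Nontrivial O] (I : Finset ι) (w : ι → ℤ) (z : ι → O) :
    (FF I w z).natDegree = TT I w := by
  rw [FF, natDegree_prod_of_monic _ _ (fun i _ => (monic_X_sub_C _).pow _), TT]
  refine Finset.sum_congr rfl fun i _ => ?_
  rw [(monic_X_sub_C _).natDegree_pow]; simp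

lemma DP (I : Finset ι) (w : ι → ℤ) (hw : ∀ i, w i ≠ 0) (z : ι → O) :
    DD I w z * PP I z = FF I w z * FF I (-w) z := by
  rw [DD, PP, FF, FF, ← Finset.prod_mul_distrib, ← Finset.prod_mul_distrib]
  refine Finset.prod_congr rfl fun i _ => ?_
  rw [← pow_succ, ← pow_add]
  congr 1
  have := hw i
  simp only [Pi.neg_apply]
  omega

lemma wron_FG (I : Finset ι) (w : ι → ℤ) (hw : ∀ i, w i ≠ 0) (z : ι → O) :
    derivative (FF I w z) * FF I (-w) z - FF I w z * derivative (FF I (-w) z)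
      = NN I w z * DD I w z := by
  have hder : ∀ v : ι → ℤ, derivative (FF I v z) = ∑ i ∈ I, (∏ j ∈ I.erase i, (X - C (z j)) ^ (v j).toNat) *
      (C (((v i).toNat : ℕ) : O) * (X - C (z i)) ^ ((v i).toNat - 1)) := by
    intro v
    rw [FF, derivative_prod_finset]
    refine Finset.sum_congr rfl fun i _ => ?_
    rw [derivative_X_sub_C_pow]
  rw [hder, hder, Finset.sum_mul, Finset.mul_sum, ← Finset.sum_sub_distrib, NN, Finset.sum_mul]
  refine Finset.sum_congr rfl fun i hi => ?_
  rw [FF, FF, DD, ← Finset.mul_prod_erase I _ hi, ← Finset.mul_prod_erase I _ hi,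
    ← Finset.mul_prod_erase I (fun i => (X - C (z i)) ^ ((w i).natAbs - 1)) hi]
  have e : (∏ j ∈ I.erase i, (X - C (z j)) ^ (w j).toNat) * ∏ j ∈ I.erase i, (X - C (z j)) ^ ((-w) j).toNat
      = (∏ j ∈ I.erase i, (X - C (z j))) * ∏ j ∈ I.erase i, (X - C (z j)) ^ ((w j).natAbs - 1) := by
    have := DP (I.erase i) w hw z
    rw [DD, PP, FF, FF] at this
    rw [← this, mul_comm]
  rcases lt_or_gt_of_ne (hw i) with h | h
  · obtain ⟨x, hx⟩ : ∃ x : ℕ, w i = -((x : ℤ) + 1) := ⟨(-w i - 1).toNat, by omega⟩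
    have a1 : (w i).toNat = 0 := by omega
    have a2 : ((-w) i).toNat = x + 1 := by simp only [Pi.neg_apply]; omega
    have a3 : (w i).natAbs - 1 = x := by omega
    rw [a1, a2, a3, hx]
    push_cast
    simp only [map_neg, map_add, map_natCast, map_one, add_tsub_cancel_right, map_zero]
    linear_combination (-((x : O[X]) + 1) * (X - C (z i)) ^ x) * e
  · obtain ⟨x, hx⟩ : ∃ x : ℕ, w i = ((x : ℤ) + 1) := ⟨(w i - 1).toNat, by omega⟩
    have a1 : ((-w) i).toNat = 0 := by simp only [Pi.neg_apply]; omega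
    have a2 : (w i).toNat = x + 1 := by omega
    have a3 : (w i).natAbs - 1 = x := by omega
    rw [a1, a2, a3, hx]
    push_cast
    simp only [map_neg, map_add, map_natCast, map_one, add_tsub_cancel_right, map_zero]
    linear_combination (((x : O[X]) + 1) * (X - C (z i)) ^ x) * e

lemma TT_neg' {I : Finset ι} {w : ι → ℤ} (h : ∑ i ∈ I, w i = 0) : TT I (-w) = TT I w := by
  rw [← TT_neg h]; rfl

/-- multiplicity count -/
lemma mult_count {k : Type*} [Field k] [CharZero k] [DecidableEq k] (H G D P : k[X]) (b : k) (hb : b ≠ 0)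
    (hH : H ≠ 0) (hG : G ≠ 0) (hP : P ≠ 0) (hW : derivative H * G - H * derivative G = C b * D)
    (hDP : D * P = G * G) (hGP : ∀ c, G.IsRoot c → P.IsRoot c) (hsp : G.Splits) :
    G.natDegree + G.roots.toFinset.card ≤ H.natDegree + P.natDegree := by
  have key : ∀ c ∈ G.roots.toFinset, (X - C c) ^ (G.rootMultiplicity c + 1) ∣ H * P := by
    intro c hc
    rw [Multiset.mem_toFinset, mem_roots hG] at hc
    obtain ⟨G1, hG1, hG1c⟩ := exists_eq_pow_rootMultiplicity_mul_and_not_dvd G hG c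
    obtain ⟨H1, hH1, hH1c⟩ := exists_eq_pow_rootMultiplicity_mul_and_not_dvd H hH c
    have hPc : X - C c ∣ P := dvd_iff_isRoot.mpr (hGP c hc)
    set T := G.rootMultiplicity c
    set e := H.rootMultiplicity c
    by_cases heT : e = T
    · rw [pow_succ]
      exact mul_dvd_mul (heT ▸ Dvd.intro _ hH1.symm) hPc
    set R := C ((e : k) - T) * (H1 * G1) + (X - C c) * (derivative H1 * G1 - H1 * derivative G1) with hR
    have hpd : ∀ m : ℕ, (X - C c) * derivative ((X - C c) ^ m) = C (m : k) * (X - C c) ^ m := by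
      intro m
      rw [derivative_X_sub_C_pow]
      rcases m with _ | m
      · simp
      · simp only [add_tsub_cancel_right]; ring
    have h1 : (X - C c) * (derivative H * G - H * derivative G) = (X - C c) ^ T * ((X - C c) ^ e * R) := by
      rw [hG1, hH1, hR, derivative_mul, derivative_mul]
      have p1 := hpd e
      have p2 := hpd T
      rw [map_sub]
      linear_combination (H1 * (X - C c) ^ T * G1) * p1 - (H1 * (X - C c) ^ e * G1) * p2
    have hprime := prime_X_sub_C c
    have hRc : ¬ X - C c ∣ R := by
      rw [hR, dvd_add_left (dvd_mul_right _ _)]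
      intro h
      rcases hprime.dvd_or_dvd h with h | h
      · have := (dvd_iff_isRoot.mp h)
        simp only [IsRoot, eval_C] at this
        exact heT (by exact_mod_cast sub_eq_zero.mp this)
      · rcases hprime.dvd_or_dvd h with h | h
        · exact hH1c h
        · exact hG1c h
    have h2 : (X - C c) ^ T * ((X - C c) ^ (T + 1) * (C b * (G1 * G1))) =
        (X - C c) ^ T * (((X - C c) ^ e * P) * R) := by
      have h3 : (X - C c) * (C b * D) * P = (X - C c) * C b * (G * G) := by rw [← hDP]; ring
      rw [← hW, h1] at h3
      calc _ = (X - C c) * C b * (((X - C c) ^ T * G1) * ((X - C c) ^ T * G1)) := by ring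
        _ = (X - C c) * C b * (G * G) := by rw [← hG1]
        _ = _ := by rw [← h3]; ring
    have h4 := mul_left_cancel₀ (pow_ne_zero _ (X_sub_C_ne_zero c)) h2
    have h5 : (X - C c) ^ (T + 1) ∣ ((X - C c) ^ e * P) * R := ⟨_, h4.symm⟩
    have h6 := hprime.pow_dvd_of_dvd_mul_right _ hRc h5
    exact h6.trans (mul_dvd_mul_right (Dvd.intro _ hH1.symm) _)
  have hdvd : ∏ c ∈ G.roots.toFinset, (X - C c) ^ (G.rootMultiplicity c + 1) ∣ H * P := by
    apply Finset.prod_dvd_of_coprime _ key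
    intro x _ y _ hxy
    exact (isCoprime_X_sub_C_of_isUnit_sub (sub_ne_zero.mpr hxy).isUnit).pow
  have h7 := natDegree_le_of_dvd hdvd (mul_ne_zero hH hP)
  rw [natDegree_mul hH hP, natDegree_prod_of_monic _ _ (fun i _ => (monic_X_sub_C _).pow _)] at h7
  have h8 : ∑ c ∈ G.roots.toFinset, ((X - C c) ^ (G.rootMultiplicity c + 1)).natDegree
      = G.natDegree + G.roots.toFinset.card := by
    have : ∀ c ∈ G.roots.toFinset, ((X - C c) ^ (G.rootMultiplicity c + 1)).natDegree = G.roots.count c + 1 := by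
      intro c _
      rw [(monic_X_sub_C _).natDegree_pow, count_roots]; simp
    rw [Finset.sum_congr rfl this, Finset.sum_add_distrib, Multiset.toFinset_sum_count_eq]
    simp [hsp.natDegree_eq_card_roots]
  omega
end wron

section val
variable {ι O : Type*} [DecidableEq ι] [CommRing O] [IsDomain O] [ValuationRing O]
  [CharZero (IsLocalRing.ResidueField O)]

lemma lemE (w : ι → ℤ) (hw : ∀ i, w i ≠ 0) (I : Finset ι) (z : ι → O) (hsum : ∑ i ∈ I, w i = 0)
    (B c : O) (hB : B ≠ 0) (hBu : ¬ IsUnit B) (hc : ¬ IsUnit c)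
    (hN : NN I w z = C B * (1 + C c * X)) (i0 j0 : ι) (hi0 : i0 ∈ I) (hj0 : j0 ∈ I)
    (hu : IsUnit (z i0 - z j0)) : False := by
  classical
  set r := IsLocalRing.residue O with hr
  have hnu : ∀ x : O, ¬ IsUnit x → r x = 0 := fun x hx => (IsLocalRing.residue_eq_zero_iff x).mpr hx
  set F := FF I w z with hF
  set G := FF I (-w) z with hG
  set D := DD I w z with hD
  have hw1 : derivative F * G - F * derivative G = NN I w z * D := wron_FG I w hw z
  set H := F - G with hH
  have hw2 : derivative H * G - H * derivative G = NN I w z * D := by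
    rw [← hw1, hH, derivative_sub]; ring
  have hFm : F.Monic := FF_monic _ _ _
  have hGm : G.Monic := FF_monic _ _ _
  have hDm : D.Monic := DD_monic _ _ _
  have hFd : F.natDegree = TT I w := FF_natDegree _ _ _
  have hGd : G.natDegree = TT I w := by rw [hG, FF_natDegree, TT_neg' hsum]
  have hGrd : (G.map r).natDegree = TT I w := by rw [hGm.natDegree_map, hGd]
  have hNne : NN I w z ≠ 0 := by
    rw [hN]
    refine mul_ne_zero (by simpa) ?_
    intro h
    have := congrArg (fun p => coeff p 0) h
    simp at this
  have hHdeg : H.degree < TT I w := by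
    have := degree_sub_lt (p := F) (q := G) (by rw [degree_eq_natDegree hFm.ne_zero, degree_eq_natDegree hGm.ne_zero, hFd, hGd]) hFm.ne_zero
      (by rw [hFm.leadingCoeff, hGm.leadingCoeff])
    rwa [degree_eq_natDegree hFm.ne_zero, hFd] at this
  have hHne : H ≠ 0 := by
    intro h
    rw [h] at hw2
    simp only [derivative_zero, zero_mul, sub_zero] at hw2
    exact mul_ne_zero hNne hDm.ne_zero hw2.symm
  -- residue: H maps to zero
  have hdegr : ∀ Q : O[X], Q.degree < TT I w → Q.map r ≠ 0 → (Q.map r).natDegree < (G.map r).natDegree := by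
    intro Q hQ h0
    rw [hGrd]
    exact (natDegree_lt_iff_degree_lt h0).mpr (lt_of_le_of_lt degree_map_le hQ)
  have hH0 : H.map r = 0 := by
    by_contra h
    have := (wron_deg h (hdegr H hHdeg h)).1
    apply this
    rw [derivative_map, derivative_map, ← Polynomial.map_mul, ← Polynomial.map_mul, ← Polynomial.map_sub, hw2, hN]
    simp [hnu B hBu]
  have hFG : F.map r = G.map r := by
    rw [hH, Polynomial.map_sub, sub_eq_zero] at hH0; exact hH0
  -- content
  obtain ⟨l, hl, hmin⟩ := exists_min H.support (nonempty_support_iff.mpr hHne) H.coeff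
  obtain ⟨H0, hH0e⟩ : C (H.coeff l) ∣ H := by
    rw [C_dvd_iff_dvd_coeff]
    intro j
    by_cases hj : j ∈ H.support
    · exact hmin j hj
    · rw [notMem_support_iff.mp hj]; exact dvd_zero _
  set γ := H.coeff l with hγ
  have hγ0 : γ ≠ 0 := mem_support_iff.mp hl
  have hcl : H0.coeff l = 1 := by
    have := congrArg (fun p => coeff p l) hH0e
    simp only [coeff_C_mul] at this
    rw [← hγ] at this
    exact mul_left_cancel₀ hγ0 (by rw [← this, mul_one])
  have hH0r : H0.map r ≠ 0 := by
    intro h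
    have := congrArg (fun p => coeff p l) h
    simp [hcl] at this
  have hH0d : H0.degree < TT I w := by
    rw [hH0e, degree_C_mul hγ0] at hHdeg; exact hHdeg
  set W := derivative H0 * G - H0 * derivative G with hWd
  have hγW : C γ * W = C B * ((1 + C c * X) * D) := by
    rw [← mul_assoc, ← hN, ← hw2, hH0e, hWd, derivative_C_mul]; ring
  have hwd := wron_deg hH0r (hdegr H0 hH0d hH0r)
  have hWr : W.map r = derivative (H0.map r) * G.map r - H0.map r * derivative (G.map r) := by
    rw [hWd]; simp [derivative_map]
  rw [← hWr] at hwd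
  have hEr : ((1 + C c * X) * D).map r = D.map r := by simp [hnu c hc]
  have hDr0 : D.map r ≠ 0 := (hDm.map r).ne_zero
  obtain ⟨b, hb, hbW⟩ : ∃ b, b ≠ 0 ∧ W.map r = C b * D.map r := by
    rcases ValuationRing.dvd_total γ B with ⟨u, hu⟩ | ⟨u, hu⟩
    · rw [hu, C_mul, mul_assoc] at hγW
      have := mul_left_cancel₀ (C_ne_zero.mpr hγ0) hγW
      have h2 : W.map r = C (r u) * D.map r := by rw [this, Polynomial.map_mul, hEr, map_C]
      refine ⟨r u, ?_, h2⟩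
      intro h
      rw [h] at h2
      exact hwd.1 (by simpa using h2)
    · rw [hu, C_mul, mul_assoc] at hγW
      have := mul_left_cancel₀ (C_ne_zero.mpr hB) hγW
      have h2 : C (r u) * W.map r = D.map r := by rw [← hEr, ← this, Polynomial.map_mul, map_C]
      have h3 : r u ≠ 0 := by
        intro h
        rw [h] at h2
        exact hDr0 (by simpa using h2.symm)
      refine ⟨(r u)⁻¹, inv_ne_zero h3, ?_⟩
      rw [← h2, ← mul_assoc, ← C_mul, inv_mul_cancel₀ h3]; simp
  set P := PP I z with hP
  have hPm : P.Monic := PP_monic _ _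
  have hDP : D.map r * P.map r = G.map r * G.map r := by
    rw [← Polynomial.map_mul, DP I w hw z, Polynomial.map_mul, ← hF, hFG]
  have hGr : G.map r = ∏ i ∈ I, (X - C (r (z i))) ^ (-w i).toNat := by
    rw [hG, FF_map, FF]; rfl
  have hPr : P.map r = ∏ i ∈ I, (X - C (r (z i))) := by rw [hP, PP_map, PP]
  have hGr0 : G.map r ≠ 0 := (hGm.map r).ne_zero
  have hcount := mult_count (H0.map r) (G.map r) (D.map r) (P.map r) b hb hH0r hGr0
    (hPm.map r).ne_zero (by rw [← hWr, hbW]) hDP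
    (by
      intro x hx
      rw [hGr, IsRoot, eval_prod, Finset.prod_eq_zero_iff] at hx
      obtain ⟨i, hi, hx⟩ := hx
      rw [hPr, IsRoot, eval_prod, Finset.prod_eq_zero_iff]
      refine ⟨i, hi, ?_⟩
      rw [eval_pow] at hx
      exact eq_zero_of_pow_eq_zero hx)
    (by
      rw [hGr]
      exact Splits.prod fun i _ => (Splits.X_sub_C _).pow _)
  have hroot : ∀ i ∈ I, r (z i) ∈ (G.map r).roots.toFinset := by
    intro i hi
    rw [Multiset.mem_toFinset, mem_roots hGr0, IsRoot]
    have h1 := congrArg (eval (r (z i))) hDP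
    rw [eval_mul, eval_mul] at h1
    have h2 : eval (r (z i)) (P.map r) = 0 := by
      rw [hPr, eval_prod, Finset.prod_eq_zero hi]; simp
    rw [h2, mul_zero] at h1
    exact mul_self_eq_zero.mp h1.symm
  have h2le : 2 ≤ (G.map r).roots.toFinset.card := by
    have : 1 < (G.map r).roots.toFinset.card := by
      rw [Finset.one_lt_card]
      refine ⟨_, hroot i0 hi0, _, hroot j0 hj0, ?_⟩
      intro h
      have h3 : r (z i0 - z j0) = 0 := by rw [map_sub, h, sub_self]
      exact (hu.map r).ne_zero h3
    exact this
  have hd1 := congrArg natDegree hbW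
  rw [natDegree_C_mul hb] at hd1
  have hd2 := congrArg natDegree hDP
  rw [natDegree_mul hDr0 (hPm.map r).ne_zero, natDegree_mul hGr0 hGr0] at hd2
  have := hwd.2
  omega
end val
end ZZ

namespace ZZ

def GoodW (k : Type*) [Field k] (ι : Type*) [Fintype ι] (w : ι → ℤ) : Prop :=
  ∃ z : ι → k, Function.Injective z ∧ ∀ l : ℕ, l + 2 ≤ Fintype.card ι → ∑ i, (w i : k) * z i ^ l = 0

lemma NN_ps {ι O : Type*} [DecidableEq ι] [CommRing O] [IsDomain O] (I : Finset ι) (w : ι → ℤ) (z : ι → O) :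
    NN I w z = ∑ k ∈ Finset.range (I.card + 1), C ((PP I z).coeff k) *
      ∑ a ∈ Finset.range k, X ^ a * C (∑ i ∈ I, (w i : O) * z i ^ (k - 1 - a)) := by
  have h1 : ∀ i ∈ I, ∏ j ∈ I.erase i, (X - C (z j)) = ∑ k ∈ Finset.range (I.card + 1), C ((PP I z).coeff k) *
      ∑ a ∈ Finset.range k, X ^ a * C (z i) ^ (k - 1 - a) := by
    intro i hi
    apply mul_right_cancel₀ (X_sub_C_ne_zero (z i))
    rw [Finset.sum_mul]
    have h2 : ∀ k ∈ Finset.range (I.card + 1), (C ((PP I z).coeff k) *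
      ∑ a ∈ Finset.range k, X ^ a * C (z i) ^ (k - 1 - a)) * (X - C (z i)) =
        C ((PP I z).coeff k) * X ^ k - C ((PP I z).coeff k * z i ^ k) := by
      intro k _
      rw [mul_assoc, geom_sum₂_mul]
      simp; ring
    rw [Finset.sum_congr rfl h2, Finset.sum_sub_distrib]
    have h3 := (PP I z).as_sum_range_C_mul_X_pow
    rw [PP_natDegree] at h3
    rw [← h3, ← map_sum]
    have h4 := eval_eq_sum_range (p := PP I z) (z i)
    rw [PP_natDegree] at h4
    rw [← h4, mul_comm]
    have h5 := PP_erase I z hi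
    rw [← h5]
    simp [PP]
  rw [NN, Finset.sum_congr rfl (fun i hi => by rw [h1 i hi])]
  simp only [Finset.mul_sum, map_sum]
  rw [Finset.sum_comm]
  refine Finset.sum_congr rfl fun k _ => ?_
  rw [Finset.sum_comm]
  refine Finset.sum_congr rfl fun a _ => ?_
  refine Finset.sum_congr rfl fun i _ => ?_
  simp; ring

lemma NN_coeff {ι O : Type*} [DecidableEq ι] [CommRing O] [IsDomain O] (I : Finset ι) (w : ι → ℤ) (z : ι → O)
    (n : ℕ) : (NN I w z).coeff n = ∑ k ∈ Finset.range (I.card + 1), if n < k then (PP I z).coeff k *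
      (∑ i ∈ I, (w i : O) * z i ^ (k - 1 - n)) else 0 := by
  rw [NN_ps, finsetSum_coeff]
  refine Finset.sum_congr rfl fun k _ => ?_
  rw [coeff_C_mul, finsetSum_coeff]
  simp only [coeff_mul_C, coeff_X_pow, ite_mul, one_mul, zero_mul]
  rw [Finset.sum_ite_eq]
  simp only [Finset.mem_range]
  split_ifs <;> simp

lemma NN_linear {ι O : Type*} [DecidableEq ι] [CommRing O] [IsDomain O] (I : Finset ι) (w : ι → ℤ) (z : ι → O)
    (h2 : 2 ≤ I.card) (h : ∀ l, l + 3 ≤ I.card → ∑ i ∈ I, (w i : O) * z i ^ l = 0) :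
    ∃ B, NN I w z = C (∑ i ∈ I, (w i : O) * z i ^ (I.card - 2)) * X + C B := by
  have hd : (NN I w z).natDegree ≤ 1 := by
    rw [natDegree_le_iff_coeff_eq_zero]
    intro n hn
    rw [NN_coeff]
    apply Finset.sum_eq_zero
    intro k hk
    rw [Finset.mem_range] at hk
    split_ifs with h1
    · rw [h (k - 1 - n) (by omega), mul_zero]
    · rfl
  refine ⟨(NN I w z).coeff 0, ?_⟩
  have h1 : (NN I w z).coeff 1 = ∑ i ∈ I, (w i : O) * z i ^ (I.card - 2) := by
    rw [NN_coeff, Finset.sum_eq_single I.card]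
    · have h3 : (PP I z).coeff I.card = 1 := by
        have := (PP_monic I z).coeff_natDegree
        rwa [PP_natDegree] at this
      rw [h3, if_pos (by omega), one_mul]
      rfl
    · intro k hk hne
      rw [Finset.mem_range] at hk
      split_ifs with h1
      · rw [h (k - 1 - 1) (by omega), mul_zero]
      · rfl
    · intro h; simp at h
  rw [← h1]
  exact eq_X_add_C_of_natDegree_le_one hd

lemma ps_shift {ι O : Type*} [CommRing O] (I : Finset ι) (w : ι → ℤ) (z : ι → O) (c : O) (l : ℕ)
    (h : ∀ k, k < l → ∑ i ∈ I, (w i : O) * z i ^ k = 0) :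
    ∑ i ∈ I, (w i : O) * (z i + c) ^ l = ∑ i ∈ I, (w i : O) * z i ^ l := by
  have : ∀ i ∈ I, (w i : O) * (z i + c) ^ l = ∑ k ∈ Finset.range (l + 1),
      ((w i : O) * z i ^ k) * (c ^ (l - k) * (l.choose k)) := by
    intro i _
    rw [add_pow, Finset.mul_sum]
    exact Finset.sum_congr rfl fun k _ => by ring
  rw [Finset.sum_congr rfl this, Finset.sum_comm, Finset.sum_range_succ, Finset.sum_eq_zero]
  · simp
  · intro k hk
    rw [← Finset.sum_mul, h k (Finset.mem_range.mp hk), zero_mul]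

lemma descent {K κ : Type*} [Field K] [IsAlgClosed K] [Field κ] [Algebra K κ] {ι : Type*} [Fintype ι]
    (w : ι → ℤ) (h : GoodW κ ι w) : GoodW K ι w := by
  classical
  obtain ⟨z, hz, hp⟩ := h
  set q : ℕ → MvPolynomial ι K := fun l => ∑ i, (w i : MvPolynomial ι K) * MvPolynomial.X i ^ l with hq
  set J : Ideal (MvPolynomial ι K) := Ideal.span {f | ∃ l, l + 2 ≤ Fintype.card ι ∧ f = q l} with hJ
  set d : MvPolynomial ι K := ∏ p ∈ (Finset.univ : Finset ι).offDiag, (MvPolynomial.X p.1 - MvPolynomial.X p.2) with hd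
  by_contra hcon
  have h1 : d ∈ MvPolynomial.vanishingIdeal K (MvPolynomial.zeroLocus K J) := by
    rw [MvPolynomial.mem_vanishingIdeal_iff]
    intro x hx
    rw [MvPolynomial.mem_zeroLocus_iff] at hx
    by_contra h0
    apply hcon
    refine ⟨x, ?_, ?_⟩
    · intro i j hij
      by_contra hne
      apply h0
      rw [hd, map_prod]
      apply Finset.prod_eq_zero (i := (i, j))
      · simp [hne]
      · simp [hij]
    · intro l hl
      have := hx (q l) (Ideal.subset_span ⟨l, hl, rfl⟩)
      rw [hq] at this
      simpa using this
  rw [MvPolynomial.vanishingIdeal_zeroLocus_eq_radical] at h1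
  obtain ⟨n, hn⟩ := h1
  have h2 : J ≤ RingHom.ker (MvPolynomial.aeval (R := K) z) := by
    rw [hJ, Ideal.span_le]
    rintro f ⟨l, hl, rfl⟩
    simp only [SetLike.mem_coe, RingHom.mem_ker]
    rw [hq]
    simpa using hp l hl
  have h3 := h2 hn
  rw [RingHom.mem_ker, map_pow] at h3
  have h4 := eq_zero_of_pow_eq_zero h3
  rw [hd, map_prod, Finset.prod_eq_zero_iff] at h4
  obtain ⟨⟨i, j⟩, hij, h5⟩ := h4
  simp at hij h5
  exact hij (hz (sub_eq_zero.mp h5))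

lemma Pi_map {ι O O' : Type*} [CommRing O] [CommRing O'] (f : O →+* O') (I : Finset ι) (w : ι → ℤ) (z : ι → O) :
    f (Pi I w z) = Pi I w (fun i => f (z i)) := by
  simp [Pi, map_prod]

lemma claim {K L : Type*} [Field K] [IsAlgClosed K] [CharZero K] [Field L] [Algebra K L]
    {ι : Type*} [Fintype ι] [DecidableEq ι] (w : ι → ℤ) (hw : ∀ i, w i ≠ 0) (hsum : ∑ i, w i = 0)
    (z : ι → L) (hz : Function.Injective z) (h3 : 2 ≤ Fintype.card ι)
    (hp : ∀ l, l + 3 ≤ Fintype.card ι → ∑ i, (w i : L) * z i ^ l = 0) (A0 : K) (hA0 : A0 ≠ 0)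
    (hA : ∑ i, (w i : L) * z i ^ (Fintype.card ι - 2) = algebraMap K L A0)
    (hng : ¬ GoodW K ι w) (O : ValuationSubring L) (hO : ∀ x : K, algebraMap K L x ∈ O) :
    Pi Finset.univ w z ^ (Fintype.card ι - 2) ∈ O := by
  classical
  set M := Fintype.card ι with hM
  have hMc : (Finset.univ : Finset ι).card = M := Finset.card_univ
  obtain ⟨q, hq, hmax⟩ := Finset.exists_max_image ((Finset.univ : Finset ι).offDiag)
    (fun q => O.valuation (z q.1 - z q.2))
    (by
      obtain ⟨x, hx, y, hy, hxy⟩ := Finset.one_lt_card.mp (show 1 < (Finset.univ : Finset ι).card by omega)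
      exact ⟨(x, y), by simp [hxy]⟩)
  obtain ⟨i0, j0⟩ := q
  simp only [Finset.mem_offDiag, Finset.mem_univ, true_and] at hq
  set π := z i0 - z j0 with hπ
  have hπ0 : π ≠ 0 := sub_ne_zero.mpr (fun h => hq (hz h))
  have hmem : ∀ i, (z i - z j0) / π ∈ O := by
    intro i
    rw [← O.valuation_le_one_iff, map_div₀]
    have hv : O.valuation π ≠ 0 := (Valuation.ne_zero_iff _).mpr hπ0
    rw [div_le_one₀ (zero_lt_iff.mpr hv)]
    by_cases h : i = j0
    · simp [h]
    · exact hmax (i, j0) (by simp [h])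
  let ζ : ι → O := fun i => ⟨(z i - z j0) / π, hmem i⟩
  have hζ : ∀ i, ((ζ i : O) : L) = (z i - z j0) / π := fun i => rfl
  let emb : K →+* O := (algebraMap K L).codRestrict O.toSubring hO
  let ρ : K →+* IsLocalRing.ResidueField O := (IsLocalRing.residue O).comp emb
  haveI : CharZero (IsLocalRing.ResidueField O) := charZero_of_injective_ringHom ρ.injective
  letI : Algebra K (IsLocalRing.ResidueField O) := ρ.toAlgebra
  have hps : ∀ l, (∀ k < l, ∑ i, (w i : L) * z i ^ k = 0) →
      ((∑ i, (w i : O) * ζ i ^ l : O) : L) = (∑ i, (w i : L) * z i ^ l) / π ^ l := by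
    intro l hl
    push_cast
    rw [← ps_shift Finset.univ w z (- z j0) l hl, Finset.sum_div]
    refine Finset.sum_congr rfl fun i _ => ?_
    rw [hζ, div_pow, mul_div_assoc, sub_eq_add_neg]
  have hps0 : ∀ l, l + 3 ≤ M → ∑ i, (w i : O) * ζ i ^ l = 0 := by
    intro l hl
    apply Subtype.ext
    rw [hps l (fun k hk => hp k (by omega)), hp l hl]; simp
  set A : O := ∑ i, (w i : O) * ζ i ^ (M - 2) with hAd
  have hAL : (A : L) = algebraMap K L A0 / π ^ (M - 2) := by
    rw [hAd, hps (M - 2) (fun k hk => hp k (by omega)), hA]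
  have hA0L : algebraMap K L A0 ≠ 0 := by simpa using hA0
  have hAne : A ≠ 0 := by
    intro h
    rw [h] at hAL
    have : algebraMap K L A0 / π ^ (M - 2) ≠ 0 := div_ne_zero hA0L (pow_ne_zero _ hπ0)
    exact this (by rw [← hAL]; rfl)
  have hAneL : (A : L) ≠ 0 := by
    intro h; exact hAne (Subtype.ext h)
  have hdiff : ∀ i j, z i - z j = π * ((ζ i : L) - ζ j) := by
    intro i j
    rw [hζ, hζ]; field_simp; ring
  suffices hdvd : A ^ (TT Finset.univ w ^ 2) ∣ Pi Finset.univ w ζ ^ (M - 2) by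
    obtain ⟨R, hR⟩ := hdvd
    have hR' : (Pi Finset.univ w (fun i => ((ζ i : O) : L))) ^ (M - 2) = (A : L) ^ (TT Finset.univ w ^ 2) * R := by
      have := congrArg (O.subtype) hR
      rw [map_pow, map_mul, map_pow, Pi_map] at this
      exact this
    rw [Pi_scale hsum z (fun i => (ζ i : L)) π (fun i _ j _ => hdiff i j), mul_pow, hR', ← mul_assoc,
      ← pow_mul, mul_comm (TT _ _ ^ 2), pow_mul, ← mul_pow, hAL, mul_div_cancel₀ _ (pow_ne_zero _ hπ0)]
    exact O.mul_mem _ _ (O.toSubring.pow_mem (hO A0) _) R.2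
  by_cases hAu : IsUnit A
  · exact (hAu.pow _).dvd
  set r := IsLocalRing.residue O with hr
  have hnu : ∀ x : O, ¬ IsUnit x → r x = 0 := fun x hx => (IsLocalRing.residue_eq_zero_iff x).mpr hx
  have hrA : r A = 0 := hnu A hAu
  obtain ⟨B, hB⟩ := NN_linear Finset.univ w ζ (by omega) (by rw [hMc]; exact hps0)
  rw [hMc, ← hAd] at hB
  have hninj : ¬ Function.Injective (fun i => r (ζ i)) := by
    intro hinj
    apply hng
    apply descent (κ := IsLocalRing.ResidueField O)
    refine ⟨_, hinj, ?_⟩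
    intro l hl
    have h1 : ∑ i, (w i : IsLocalRing.ResidueField O) * r (ζ i) ^ l = r (∑ i, (w i : O) * ζ i ^ l) := by
      simp
    rw [h1]
    by_cases hl2 : l + 3 ≤ M
    · rw [hps0 l hl2, map_zero]
    · have : l = M - 2 := by omega
      rw [this, ← hAd, hrA]
  have hBu : ¬ IsUnit B := by
    intro hBu
    apply hninj
    intro i j hij
    by_contra hne
    have h1 := NN_eval Finset.univ w (fun i => r (ζ i)) (Finset.mem_univ i)
    rw [← NN_map, hB, Finset.prod_eq_zero (i := j) (by simp [Ne.symm hne]) (by simpa using sub_eq_zero.mpr hij)] at h1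
    simp [hrA] at h1
    exact (hBu.map r).ne_zero h1
  have hunit : IsUnit (ζ i0 - ζ j0) := by
    have : ζ i0 - ζ j0 = 1 := by
      apply Subtype.ext
      push_cast
      have := hdiff i0 j0
      exact mul_left_cancel₀ hπ0 (by rw [← this, mul_one])
    rw [this]; exact isUnit_one
  have hζinj : Function.Injective ζ := by
    intro i j hij
    apply hz
    have := hdiff i j
    rw [hij, sub_self, mul_zero] at this
    exact sub_eq_zero.mp this
  have hdone : A ∣ B → A ^ (TT Finset.univ w ^ 2) ∣ Pi Finset.univ w ζ ^ (M - 2) := by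
    rintro ⟨y, hy⟩
    have hCA : C A ∣ NN Finset.univ w ζ := by
      refine ⟨X + C y, ?_⟩
      rw [hB, hy, C_mul]; ring
    have := lemS w hw Finset.univ ζ A hCA hAu i0 j0 (Finset.mem_univ _) (Finset.mem_univ _) hunit hsum
      (fun J _ _ hs hd => lemR w hw J.card J rfl ζ (hζinj.injOn) A hd hs)
    rwa [hMc] at this
  rcases ValuationRing.dvd_total A B with h | ⟨c, hc⟩
  · exact hdone h
  by_cases hcu : IsUnit c
  · apply hdone
    obtain ⟨u, rfl⟩ := hcu
    exact ⟨(u⁻¹ : Oˣ), by rw [hc, mul_assoc]; simp⟩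
  exfalso
  refine lemE w hw Finset.univ ζ hsum B c ?_ hBu hcu ?_ i0 j0 (Finset.mem_univ _) (Finset.mem_univ _) hunit
  · rintro rfl
    exact hAne (by rw [hc, zero_mul])
  · rw [hB, hc, C_mul]; ring
end ZZ

namespace ZZ

lemma mem_range_of_val {K L : Type*} [Field K] [IsAlgClosed K] [Field L] [Algebra K L] (h : L)
    (hh : ∀ O : ValuationSubring L, (∀ x : K, algebraMap K L x ∈ O) → h ∈ O) :
    ∃ u : K, algebraMap K L u = h := by
  have h1 : h ∈ (⨅ V : {V : ValuationSubring L // Set.range (algebraMap K L) ⊆ V.toSubring}, V.1.toSubring) := by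
    rw [Subring.mem_iInf]
    rintro ⟨V, hV⟩
    exact hh V (fun x => hV ⟨x, rfl⟩)
  rw [iInf_valuationSubring_superset] at h1
  obtain ⟨p, hp, hpe⟩ : IsIntegral (Subring.closure (Set.range (algebraMap K L))) h := h1
  have hcl : ∀ x ∈ Subring.closure (Set.range (algebraMap K L)), ∃ u, algebraMap K L u = x := by
    intro x hx
    have : Subring.closure (Set.range (algebraMap K L)) ≤ (algebraMap K L).range := by
      rw [Subring.closure_le]; rintro _ ⟨u, rfl⟩; exact ⟨u, rfl⟩
    exact this hx
  have hl : p.map (algebraMap _ L) ∈ lifts (algebraMap K L) := by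
    rw [lifts_iff_coeff_lifts]
    intro n
    rw [coeff_map]
    exact hcl _ (p.coeff n).2
  obtain ⟨q, hq, -, hqm⟩ := lifts_and_natDegree_eq_and_monic hl (hp.map _)
  have hint : IsIntegral K h := by
    refine ⟨q, hqm, ?_⟩
    rw [← eval_map, hq, eval_map]
    exact hpe
  exact minpoly.mem_range_of_degree_eq_one K h (IsAlgClosed.degree_eq_one_of_irreducible K (minpoly.irreducible hint))

section hensel
variable {K : Type*} [Field K] [CharZero K]

lemma vand_solve {r : ℕ} (ζ : Fin r → K) (hζ : Function.Injective ζ) (b : Fin r → K) :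
    ∃ u : Fin r → K, ∀ s : Fin r, ∑ j, ζ j ^ (s : ℕ) * u j = b s := by
  have hd := Matrix.det_vandermonde_ne_zero_iff.mpr hζ
  have hu : IsUnit (Matrix.vandermonde ζ).transpose.det := by
    rw [Matrix.det_transpose]; exact hd.isUnit
  refine ⟨(Matrix.vandermonde ζ).transpose⁻¹.mulVec b, fun s => ?_⟩
  have : (Matrix.vandermonde ζ).transpose.mulVec ((Matrix.vandermonde ζ).transpose⁻¹.mulVec b) = b := by
    rw [Matrix.mulVec_mulVec, Matrix.mul_nonsing_inv _ hu, Matrix.one_mulVec]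
  have h2 := congrFun this s
  rw [Matrix.mulVec, dotProduct] at h2
  simpa [Matrix.vandermonde_apply] using h2

def HP {r : ℕ} (w ζ : Fin r → K) (E : ℕ → PowerSeries K) (k : ℕ) (Z : Fin r → PowerSeries K) : Prop :=
  (∀ j, PowerSeries.constantCoeff (Z j) = ζ j) ∧
  ∀ l, 1 ≤ l → l ≤ r → PowerSeries.X ^ (k + 1) ∣ ∑ j, PowerSeries.C (w j) * Z j ^ l - E l

lemma HP_step {r : ℕ} (w ζ : Fin r → K) (hw : ∀ j, w j ≠ 0) (hζ : Function.Injective ζ)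
    (E : ℕ → PowerSeries K) (k : ℕ) (Z : Fin r → PowerSeries K) (h : HP w ζ E k Z) :
    ∃ Z', HP w ζ E (k + 1) Z' ∧ ∀ j, PowerSeries.X ^ (k + 1) ∣ Z' j - Z j := by
  obtain ⟨h1, h2⟩ := h
  have h3 : ∀ s : Fin r, ∃ Q, ∑ j, PowerSeries.C (w j) * Z j ^ ((s : ℕ) + 1) - E (s + 1) = PowerSeries.X ^ (k + 1) * Q :=
    fun s => h2 (s + 1) (by omega) (by omega)
  choose Q hQ using h3
  obtain ⟨u, hu⟩ := vand_solve ζ hζ (fun s => - PowerSeries.constantCoeff (Q s) / ((s : ℕ) + 1 : K))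
  refine ⟨fun j => Z j + PowerSeries.X ^ (k + 1) * PowerSeries.C (u j / w j), ⟨?_, ?_⟩, ?_⟩
  · intro j
    simp [h1 j]
  · intro l hl hlr
    obtain ⟨s, rfl⟩ : ∃ s, l = s + 1 := ⟨l - 1, by omega⟩
    have hs := hu ⟨s, by omega⟩
    have hq := hQ ⟨s, by omega⟩
    set q := Q ⟨s, by omega⟩
    simp only at hq hs
    have he : ∀ j, ∃ y, (Z j + PowerSeries.X ^ (k + 1) * PowerSeries.C (u j / w j)) ^ (s + 1) =
        Z j ^ (s + 1) + (((s + 1 : ℕ) : PowerSeries K) * Z j ^ s) * (PowerSeries.X ^ (k + 1) * PowerSeries.C (u j / w j))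
          + y * (PowerSeries.X ^ (k + 1) * PowerSeries.C (u j / w j)) ^ 2 := by
      intro j
      obtain ⟨y, hy⟩ := Polynomial.powAddExpansion (Z j) (PowerSeries.X ^ (k + 1) * PowerSeries.C (u j / w j)) (s + 1)
      exact ⟨y, hy⟩
    choose y hy using he
    have hd : PowerSeries.X ∣ q + ∑ j, PowerSeries.C (w j) * ((((s + 1 : ℕ) : PowerSeries K) * Z j ^ s) * PowerSeries.C (u j / w j)) := by
      rw [PowerSeries.X_dvd_iff, map_add, map_sum]
      have : ∀ j ∈ Finset.univ, PowerSeries.constantCoeff (PowerSeries.C (w j) * ((((s + 1 : ℕ) : PowerSeries K) * Z j ^ s) * PowerSeries.C (u j / w j)))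
          = ((s : K) + 1) * (ζ j ^ s * u j) := by
        intro j _
        simp only [map_mul, map_pow, h1, map_natCast, PowerSeries.constantCoeff_C]
        have := hw j
        push_cast
        field_simp
      rw [Finset.sum_congr rfl this, ← Finset.mul_sum, hs]
      have : (s : K) + 1 ≠ 0 := by exact_mod_cast Nat.succ_ne_zero s
      field_simp
      ring
    have hsum : ∑ j, PowerSeries.C (w j) * (Z j + PowerSeries.X ^ (k + 1) * PowerSeries.C (u j / w j)) ^ (s + 1) - E (s + 1)
        = PowerSeries.X ^ (k + 1) * (q + ∑ j, PowerSeries.C (w j) * ((((s + 1 : ℕ) : PowerSeries K) * Z j ^ s) * PowerSeries.C (u j / w j)))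
          + PowerSeries.X ^ (k + 1 + 1) * (PowerSeries.X ^ k * ∑ j, PowerSeries.C (w j) * (y j * PowerSeries.C (u j / w j) ^ 2)) := by
      rw [mul_add, ← hq]
      simp only [Finset.mul_sum]
      rw [sub_add_eq_add_sub, sub_add_eq_add_sub, ← Finset.sum_add_distrib, ← Finset.sum_add_distrib]
      congr 1
      refine Finset.sum_congr rfl fun j _ => ?_
      rw [hy]; ring
    rw [hsum]
    refine dvd_add ?_ (dvd_mul_right _ _)
    rw [pow_succ]
    exact mul_dvd_mul_left _ hd
  · intro j
    simp

lemma hensel {r : ℕ} (w ζ : Fin r → K) (hw : ∀ j, w j ≠ 0) (hζ : Function.Injective ζ)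
    (E : ℕ → PowerSeries K)
    (hE : ∀ l, 1 ≤ l → l ≤ r → PowerSeries.constantCoeff (E l) = ∑ j, w j * ζ j ^ l) :
    ∃ Z : Fin r → PowerSeries K, (∀ j, PowerSeries.constantCoeff (Z j) = ζ j) ∧
      ∀ l, 1 ≤ l → l ≤ r → ∑ j, PowerSeries.C (w j) * Z j ^ l = E l := by
  have hstep := fun k (Z : {Z // HP w ζ E k Z}) => HP_step w ζ hw hζ E k Z.1 Z.2
  choose S hS1 hS2 using hstep
  have h0 : HP w ζ E 0 (fun j => PowerSeries.C (ζ j)) := by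
    refine ⟨by simp, ?_⟩
    intro l hl hlr
    rw [zero_add, pow_one, PowerSeries.X_dvd_iff, map_sub, hE l hl hlr]
    simp
  let seq : (k : ℕ) → {Z // HP w ζ E k Z} := fun k => Nat.rec ⟨_, h0⟩ (fun k Z => ⟨S k Z, hS1 k Z⟩) k
  have hsucc : ∀ k j, PowerSeries.X ^ (k + 1) ∣ (seq (k + 1)).1 j - (seq k).1 j := fun k j => hS2 k (seq k) j
  have hmono : ∀ k d j, PowerSeries.X ^ (k + 1) ∣ (seq (k + d)).1 j - (seq k).1 j := by
    intro k d j
    induction d with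
    | zero => simp
    | succ d ih =>
      have := dvd_add ((pow_dvd_pow _ (by omega : k + 1 ≤ k + d + 1)).trans (hsucc (k + d) j)) ih
      rw [sub_add_sub_cancel] at this
      exact this
  let Z : Fin r → PowerSeries K := fun j => PowerSeries.mk fun k => PowerSeries.coeff k ((seq k).1 j)
  have hZ : ∀ k j, PowerSeries.X ^ (k + 1) ∣ Z j - (seq k).1 j := by
    intro k j
    rw [PowerSeries.X_pow_dvd_iff]
    intro m hm
    obtain ⟨d, rfl⟩ : ∃ d, k = m + d := ⟨k - m, by omega⟩
    have := PowerSeries.X_pow_dvd_iff.mp (hmono m d j) m (by omega)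
    rw [map_sub, sub_eq_zero] at this
    rw [map_sub, PowerSeries.coeff_mk, this, sub_self]
  refine ⟨Z, ?_, ?_⟩
  · intro j
    have h1 := hZ 0 j
    rw [zero_add, pow_one, PowerSeries.X_dvd_iff, map_sub, sub_eq_zero] at h1
    rw [h1]; exact (seq 0).2.1 j
  · intro l hl hlr
    rw [← sub_eq_zero]
    ext k
    have h1 : PowerSeries.X ^ (k + 1) ∣ ∑ j, PowerSeries.C (w j) * Z j ^ l - E l := by
      have h2 := (seq k).2.2 l hl hlr
      have h3 : PowerSeries.X ^ (k + 1) ∣ ∑ j, PowerSeries.C (w j) * Z j ^ l - ∑ j, PowerSeries.C (w j) * (seq k).1 j ^ l := by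
        rw [← Finset.sum_sub_distrib]
        refine Finset.dvd_sum fun j _ => ?_
        rw [← mul_sub]
        exact ((hZ k j).trans (sub_dvd_pow_sub_pow _ _ _)).mul_left _
      have := dvd_add h3 h2
      rwa [sub_add_sub_cancel] at this
    rw [map_zero]
    exact PowerSeries.X_pow_dvd_iff.mp h1 k (by omega)
end hensel

lemma split {K : Type*} [Field K] [IsAlgClosed K] [CharZero K] {r : ℕ} (w : Fin r → ℤ) (hw : ∀ i, w i ≠ 0)
    (x y : ℤ) (hx : 0 < x) (hy : y < 0) (hxy : x + y ≠ 0) (hsum : x + y + ∑ i, w i = 0)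
    (h : GoodW K (Fin (r + 1)) (Fin.cons (x + y) w)) :
    GoodW K (Fin (r + 2)) (Fin.cons y (Fin.cons x w : Fin (r + 1) → ℤ)) := by
  obtain ⟨ζ', hinj, hp⟩ := h
  obtain ⟨a, ζ, rfl⟩ : ∃ a ζ, ζ' = Fin.cons a ζ := ⟨ζ' 0, fun j => ζ' j.succ, (Fin.cons_self_tail ζ').symm⟩
  have hr : 1 ≤ r := by
    by_contra hr
    have : r = 0 := by omega
    subst this
    simp at hsum
    exact hxy hsum
  rw [Fin.cons_injective_iff] at hinj
  obtain ⟨hna, hζ⟩ := hinj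
  set cc : ℕ → K := fun l => ((x + y : ℤ) : K) * a ^ l + ∑ j, (w j : K) * ζ j ^ l with hcc
  have hc0 : ∀ l, l + 1 ≤ r → cc l = 0 := by
    intro l hl
    have := hp l (by simp; omega)
    rw [Fin.sum_univ_succ] at this
    simpa [hcc] using this
  have hcr : cc r ≠ 0 := by
    intro h0
    have h1 := Matrix.eq_zero_of_forall_pow_sum_mul_pow_eq_zero (R := K) (n := r + 1) (f := Fin.cons a ζ)
      (v := fun i => (((Fin.cons (x + y) w : Fin (r + 1) → ℤ) i : ℤ) : K)) (Fin.cons_injective_iff.mpr ⟨hna, hζ⟩)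
      (by
        intro i
        rw [Fin.sum_univ_succ]
        have : cc i = 0 := by
          by_cases hi : (i : ℕ) + 1 ≤ r
          · exact hc0 i hi
          · have : (i : ℕ) = r := by omega
            rw [this]; exact h0
        simpa [hcc] using this)
    have h2 := congrFun h1 0
    simp at h2
    exact hxy (by exact_mod_cast h2)
  obtain ⟨Z, hZ0, hZ⟩ := hensel (fun j => (w j : K)) ζ (fun j => by exact_mod_cast hw j) hζ
    (fun l => PowerSeries.C (cc l) - PowerSeries.C (x : K) * PowerSeries.C a ^ l
      - PowerSeries.C (y : K) * (PowerSeries.C a + PowerSeries.X) ^ l)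
    (by
      intro l _ _
      simp [hcc]; ring)
  set W : Fin (r + 2) → ℤ := Fin.cons y (Fin.cons x w : Fin (r + 1) → ℤ) with hWd
  set zz : Fin (r + 2) → PowerSeries K := Fin.cons (PowerSeries.C a + PowerSeries.X)
    (Fin.cons (PowerSeries.C a) Z : Fin (r + 1) → PowerSeries K) with hzz
  have hWne : ∀ i, W i ≠ 0 := by
    intro i
    refine Fin.cases ?_ (fun i => Fin.cases ?_ (fun i => ?_) i) i
    · simpa [hWd] using hy.ne
    · simpa [hWd] using hx.ne'
    · simpa [hWd] using hw i
  have hWs : ∑ i, W i = 0 := by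
    rw [Fin.sum_univ_succ, Fin.sum_univ_succ]
    simp only [hWd, Fin.cons_zero, Fin.cons_succ]
    linarith
  have hzinj : Function.Injective zz := by
    rw [hzz, Fin.cons_injective_iff, Fin.cons_injective_iff]
    have hZa : ∀ j, PowerSeries.constantCoeff (Z j) ≠ a := by
      intro j h
      exact hna ⟨j, by rw [← hZ0 j, h]⟩
    refine ⟨?_, ?_, ?_⟩
    · rintro ⟨i, hi⟩
      revert hi
      refine Fin.cases ?_ (fun i => ?_) i
      · simp
      · intro hi
        apply hZa i
        simp only [Fin.cons_succ] at hi
        rw [hi]; simp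
    · rintro ⟨j, hj⟩
      exact hZa j (by rw [hj]; simp)
    · intro i j hij
      apply hζ
      rw [← hZ0 i, ← hZ0 j, hij]
  have hps : ∀ l, l ≤ r → ∑ i, (W i : PowerSeries K) * zz i ^ l = PowerSeries.C (cc l) := by
    intro l hl
    rw [Fin.sum_univ_succ, Fin.sum_univ_succ]
    simp only [hWd, hzz, Fin.cons_zero, Fin.cons_succ]
    rcases Nat.eq_zero_or_pos l with rfl | hl0
    · simp [hcc]; ring
    · have := hZ l hl0 hl
      simp only [map_intCast] at this
      rw [this]; ring
  by_contra hng
  set L := FractionRing (PowerSeries K)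
  set f := algebraMap (PowerSeries K) L with hf
  have hfinj : Function.Injective f := IsFractionRing.injective _ _
  have hfK : ∀ u : K, algebraMap K L u = f (PowerSeries.C u) := by
    intro u
    rw [IsScalarTower.algebraMap_apply K (PowerSeries K) L]; rfl
  have hpsL : ∀ l, l ≤ r → ∑ i, (W i : L) * (f (zz i)) ^ l = algebraMap K L (cc l) := by
    intro l hl
    rw [hfK, ← hps l hl]; simp
  obtain ⟨u, hu⟩ := mem_range_of_val (K := K) (Pi Finset.univ W (fun i => f (zz i)) ^ (Fintype.card (Fin (r + 2)) - 2))
    (fun O hO => claim W hWne hWs (fun i => f (zz i)) (hfinj.comp hzinj) (by simp)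
      (by
        intro l hl
        rw [Fintype.card_fin] at hl
        rw [hpsL l (by omega), hc0 l (by omega), map_zero]) (cc r) hcr
      (by
        rw [Fintype.card_fin]
        exact hpsL r le_rfl) hng O hO)
  rw [Fintype.card_fin, show r + 2 - 2 = r by omega, hfK, ← Pi_map, ← map_pow] at hu
  have hu2 := hfinj hu
  have hX : PowerSeries.X ∣ Pi Finset.univ W zz := by
    rw [Pi]
    refine dvd_trans ?_ (Finset.dvd_prod_of_mem _ (Finset.mem_univ (1 : Fin (r + 2))))
    refine dvd_trans ?_ (Finset.dvd_prod_of_mem _ (Finset.mem_univ (0 : Fin (r + 2))))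
    have e0 : zz 0 = PowerSeries.C a + PowerSeries.X := rfl
    have e1 : zz 1 = PowerSeries.C a := rfl
    have f0 : W 0 = y := rfl
    have f1 : W 1 = x := rfl
    rw [e0, e1, f0, f1]
    refine dvd_pow ?_ ?_
    · simp
    · apply Nat.mul_ne_zero <;> omega
  have hu0 : u = 0 := by
    have := (PowerSeries.X_dvd_iff.mp (dvd_pow hX (by omega : r ≠ 0)))
    rw [← hu2] at this
    simpa using this
  rw [hu0, map_zero] at hu2
  have h0 := eq_zero_of_pow_eq_zero hu2.symm
  rw [Pi, Finset.prod_eq_zero_iff] at h0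
  obtain ⟨i, -, h0⟩ := h0
  rw [Finset.prod_eq_zero_iff] at h0
  obtain ⟨j, -, h0⟩ := h0
  rw [pow_eq_zero_iff'] at h0
  have := hzinj (sub_eq_zero.mp h0.1)
  subst this
  apply h0.2
  rcases le_total 0 (W i) with h | h
  · have : (-W i).toNat = 0 := by omega
    rw [this, mul_zero]
  · have : (W i).toNat = 0 := by omega
    rw [this, zero_mul]

def Good (k : Type*) [Field k] (s : Multiset ℤ) : Prop :=
  ∃ L : Multiset (ℤ × k), L.map Prod.fst = s ∧ (L.map Prod.snd).Nodup ∧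
    ∀ l : ℕ, l + 2 ≤ L.card → (L.map (fun p => (p.1 : k) * p.2 ^ l)).sum = 0

lemma Good_iff {k : Type*} [Field k] {r : ℕ} (w : Fin r → ℤ) (z : Fin r → k) :
    let L : Multiset (ℤ × k) := Finset.univ.val.map (fun i => (w i, z i))
    (L.map Prod.fst = (List.ofFn w : Multiset ℤ)) ∧ ((L.map Prod.snd).Nodup ↔ Function.Injective z) ∧
      ∀ l, (L.map (fun p => (p.1 : k) * p.2 ^ l)).sum = ∑ i, (w i : k) * z i ^ l := by
  intro L
  refine ⟨?_, ?_, ?_⟩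
  · simp only [L, Multiset.map_map]
    exact Fin.univ_val_map w
  · simp only [L, Multiset.map_map]
    have : Multiset.map (Prod.snd ∘ fun i => (w i, z i)) Finset.univ.val = (List.ofFn z : Multiset k) := Fin.univ_val_map z
    rw [this, Multiset.coe_nodup, List.nodup_ofFn]
  · intro l
    simp only [L, Multiset.map_map]
    rfl

lemma Good_of_GoodW {k : Type*} [Field k] {r : ℕ} (w : Fin r → ℤ) (h : GoodW k (Fin r) w) :
    Good k (List.ofFn w : Multiset ℤ) := by
  obtain ⟨z, hz, hp⟩ := h
  obtain ⟨h1, h2, h3⟩ := Good_iff w z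
  refine ⟨_, h1, h2.mpr hz, ?_⟩
  intro l hl
  rw [h3]
  exact hp l (by simpa using hl)

open Classical in
lemma GoodW_of_Good {k : Type*} [Field k] {x : ℤ} {s : Multiset ℤ} (h : Good k (x ::ₘ s)) :
    ∃ (r : ℕ) (w : Fin r → ℤ), s = (List.ofFn w : Multiset ℤ) ∧ GoodW k (Fin (r + 1)) (Fin.cons x w) := by
  obtain ⟨L, h1, h2, h3⟩ := h
  rw [← Multiset.map_eq_cons] at h1
  obtain ⟨⟨x', a⟩, hp, hx, hs⟩ := h1
  simp only at hx
  subst hx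
  obtain ⟨L', rfl⟩ := Multiset.exists_cons_of_mem hp
  rw [Multiset.erase_cons_head] at hs
  obtain ⟨l, rfl⟩ := Quot.exists_rep L'
  let W : Fin (l.length + 1) → ℤ := Fin.cons x' (fun i => (l.get i).1)
  let z : Fin (l.length + 1) → k := Fin.cons a (fun i => (l.get i).2)
  have hL : (Finset.univ.val.map (fun i => (W i, z i)) : Multiset (ℤ × k)) = (x', a) ::ₘ (l : Multiset (ℤ × k)) := by
    rw [Fin.univ_val_map, List.ofFn_succ]
    simp only [W, z, Fin.cons_zero, Fin.cons_succ]
    rw [← Multiset.cons_coe]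
    congr 2
    exact List.ofFn_get l
  obtain ⟨g1, g2, g3⟩ := Good_iff W z
  rw [hL] at g1 g2 g3
  refine ⟨l.length, fun i => (l.get i).1, ?_, z, g2.mp h2, ?_⟩
  · rw [← hs]
    have h5 : List.ofFn (fun i => (l.get i).1) = l.map Prod.fst := by
      conv_rhs => rw [← List.ofFn_get l]
      rw [List.map_ofFn]; rfl
    rw [h5]; rfl
  · intro n hn
    have := h3 n (by simpa using hn)
    rw [← g3 n]; exact this

lemma Good_split {K : Type*} [Field K] [IsAlgClosed K] [CharZero K] (x y : ℤ) (s : Multiset ℤ)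
    (hs : ∀ a ∈ s, a ≠ 0) (hsum : x + y + s.sum = 0) (hx : 0 < x) (hy : y < 0) (hxy : x + y ≠ 0)
    (h : Good K ((x + y) ::ₘ s)) : Good K (x ::ₘ y ::ₘ s) := by
  obtain ⟨r, w, rfl, hg⟩ := GoodW_of_Good h
  have := split w (fun i => hs _ (by simp)) x y hx hy hxy (by simpa [List.sum_ofFn] using hsum) hg
  have := Good_of_GoodW _ this
  rw [List.ofFn_succ, List.ofFn_succ] at this
  simp only [Fin.cons_zero, Fin.cons_succ] at this
  rw [Multiset.cons_swap]
  exact this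
end ZZ

namespace ZZ
section chain
variable {K : Type*} [Field K]

lemma Good_base [CharZero K] (x : ℤ) : Good K (x ::ₘ {-x}) := by
  refine ⟨(x, 0) ::ₘ {(-x, 1)}, by simp, by simp, ?_⟩
  intro l hl
  have : l = 0 := by simpa using hl
  subst this
  simp

lemma Good_mul (d : ℤ) {s : Multiset ℤ} (h : Good K s) : Good K (s.map (fun x => d * x)) := by
  obtain ⟨L, rfl, h2, h3⟩ := h
  refine ⟨L.map (fun p => (d * p.1, p.2)), by simp, by simpa using h2, ?_⟩
  intro l hl
  have := h3 l (by simpa using hl)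
  rw [Multiset.map_map]
  have e : ((fun p : ℤ × K => (p.1 : K) * p.2 ^ l) ∘ fun p : ℤ × K => (d * p.1, p.2)) =
      fun p => (d : K) * ((p.1 : K) * p.2 ^ l) := by
    funext p; simp; ring
  rw [e, Multiset.sum_map_mul_left, this, mul_zero]

variable [IsAlgClosed K] [CharZero K]

lemma expand_u (a b : ℕ) (ha : 1 ≤ a) : ∀ (i : ℕ) (s : Multiset ℤ), (i - 1) * (a : ℤ) < b →
    (∀ j : ℕ, (b : ℤ) - j * a ≠ 0) →
    (∀ x ∈ s, x ≠ 0) → ((b : ℤ) - i * a) + s.sum = 0 → Good K (((b : ℤ) - i * a) ::ₘ s) →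
    Good K ((b : ℤ) ::ₘ (Multiset.replicate i (-(a : ℤ)) + s)) := by
  intro i
  induction i with
  | zero => intro s _ _ _ _ h; simpa using h
  | succ i ih =>
    intro s hi hj hs hsum h
    push_cast at hi hsum
    have h1 : Good K (((b : ℤ) - i * a) ::ₘ (-(a : ℤ)) ::ₘ s) := by
      apply Good_split
      · exact hs
      · linarith
      · linarith
      · omega
      · have := hj (i + 1)
        push_cast at this
        intro h; apply this; linarith
      · convert h using 2
        push_cast; ring
    have h2 := ih ((-(a : ℤ)) ::ₘ s) (by nlinarith) hj (by
      intro x hx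
      rcases Multiset.mem_cons.mp hx with rfl | hx
      · omega
      · exact hs x hx) (by rw [Multiset.sum_cons]; linarith) h1
    rw [Multiset.replicate_succ]
    simpa using h2

lemma expand_all (a b k : ℕ) (ha : 1 ≤ a) (hk : (k - 1) * (a : ℤ) < b) (hj : ∀ j : ℕ, (b : ℤ) - j * a ≠ 0)
    (hb : 1 ≤ b) :
    ∀ (r : ℕ) (s : Multiset ℤ), (∀ x ∈ s, x ≠ 0) → r * ((b : ℤ) - k * a) + s.sum = 0 →
    Good K (Multiset.replicate r ((b : ℤ) - k * a) + s) →
    Good K (Multiset.replicate r (b : ℤ) + Multiset.replicate (r * k) (-(a : ℤ)) + s) := by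
  intro r
  induction r with
  | zero => intro s _ _ h; simpa using h
  | succ r ih =>
    intro s hs hsum h
    rw [Multiset.replicate_succ, Multiset.cons_add] at h
    have h1 := expand_u a b ha k _ hk hj (by
      intro x hx
      rw [Multiset.mem_add] at hx
      rcases hx with hx | hx
      · rw [Multiset.eq_of_mem_replicate hx]; exact hj k
      · exact hs x hx) (by
      rw [Multiset.sum_add, Multiset.sum_replicate, nsmul_eq_mul]
      push_cast at hsum; linarith) h
    have h2 := ih ((b : ℤ) ::ₘ (Multiset.replicate k (-(a : ℤ)) + s)) (by
      intro x hx
      rw [Multiset.mem_cons, Multiset.mem_add] at hx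
      rcases hx with rfl | hx | hx
      · omega
      · rw [Multiset.eq_of_mem_replicate hx]; omega
      · exact hs x hx) (by
      rw [Multiset.sum_cons, Multiset.sum_add, Multiset.sum_replicate, nsmul_eq_mul]
      push_cast at hsum; linarith) (by
      convert h1 using 1
      simp only [← Multiset.singleton_add]
      abel)
    convert h2 using 1
    rw [Nat.succ_mul, Multiset.replicate_succ, Multiset.replicate_add (r * k)]
    simp only [← Multiset.singleton_add]
    abel

lemma chain (a b k : ℕ) (ha : 2 ≤ a) (hab : a < b) (hco : Nat.Coprime a b)
    (hk1 : (k - 1) * (a : ℤ) < b) (hk2 : (b : ℤ) < k * a) (hj : ∀ j : ℕ, (b : ℤ) - j * a ≠ 0) :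
    ∀ (N B A r : ℕ) (v : ℤ), B + A + r = N → v + b * B - a * A + (b - k * a) * r = 0 → v ≠ 0 →
      1 - (a : ℤ) ≤ v → v ≤ b → a * r ≤ B + r → B + r < a * (r + 1) →
      Good K (v ::ₘ (Multiset.replicate B (b : ℤ) + Multiset.replicate A (-(a : ℤ)) +
        Multiset.replicate r ((b : ℤ) - k * a))) := by
  have hkb : k ≤ b := by
    by_contra h
    have : (b : ℤ) ≤ k - 1 := by omega
    nlinarith
  have hk0 : 1 ≤ k := by
    by_contra h
    have : k = 0 := by omega
    subst this; simp at hk2; omega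
  have hu : (b : ℤ) - k * a ≠ 0 := hj k
  have hne : ∀ (B A r : ℕ), ∀ x ∈ (Multiset.replicate B (b : ℤ) + Multiset.replicate A (-(a : ℤ)) +
        Multiset.replicate r ((b : ℤ) - k * a)), x ≠ 0 := by
    intro B A r x hx
    rw [Multiset.mem_add, Multiset.mem_add] at hx
    rcases hx with (hx | hx) | hx <;> rw [Multiset.eq_of_mem_replicate hx]
    · omega
    · omega
    · exact hu
  have hsm : ∀ (B A r : ℕ), (Multiset.replicate B (b : ℤ) + Multiset.replicate A (-(a : ℤ)) +
        Multiset.replicate r ((b : ℤ) - k * a)).sum = b * B - a * A + (b - k * a) * r := by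
    intro B A r
    simp only [Multiset.sum_add, Multiset.sum_replicate, nsmul_eq_mul]
    ring
  intro N
  induction N with
  | zero =>
    intro B A r v hN hs hv
    have : B = 0 ∧ A = 0 ∧ r = 0 := by omega
    obtain ⟨rfl, rfl, rfl⟩ := this
    simp at hs
    exact absurd hs hv
  | succ N ih =>
    intro B A r v hN hs hv h1 h2 h3 h4
    have h3' : (a : ℤ) * r ≤ B + r := by exact_mod_cast h3
    have h4' : (B : ℤ) + r < a * (r + 1) := by exact_mod_cast h4
    have hdv : ∀ t : ℤ, (B : ℤ) + r = t → (a : ℤ) ∣ v → (a : ℤ) ∣ t := by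
      intro t ht hav
      have : (a : ℤ) ∣ b * t := by
        obtain ⟨y, hy⟩ := hav
        refine ⟨A + k * r - y, ?_⟩
        rw [← ht]; linear_combination hs - hy
      have hc : IsCoprime (a : ℤ) b := Nat.isCoprime_iff_coprime.mpr hco
      exact hc.dvd_of_dvd_mul_left this
    rcases lt_trichotomy v 0 with hv0 | hv0 | hv0
    · -- merge b
      have hBr : (B : ℤ) + r ≠ a * r := by
        intro h
        have : (a : ℤ) ∣ v := ⟨A + k * r - b * r, by linear_combination hs - (b : ℤ) * h⟩
        obtain ⟨y, rfl⟩ := this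
        have : y < 0 := by nlinarith
        nlinarith
      have hB : 1 ≤ B := by
        by_contra h
        have h0 : B = 0 := by omega
        subst h0
        push_cast at hBr h3'
        have : (a : ℤ) * r < r := by
          rcases lt_or_eq_of_le h3' with h | h
          · linarith
          · exact absurd h.symm hBr
        nlinarith
      obtain ⟨B, rfl⟩ : ∃ B', B = B' + 1 := ⟨B - 1, by omega⟩
      push_cast at hs h3' h4' hBr
      have h5 := ih B A r (b + v) (by omega) (by linarith) (by omega) (by omega) (by omega)
        (by
          have : (a : ℤ) * r ≤ B + r := by
            have := lt_of_le_of_ne h3' (Ne.symm hBr); linarith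
          exact_mod_cast this)
        (by omega)
      have h6 := Good_split (b : ℤ) v _ (hne B A r) (by rw [hsm]; linarith) (by omega) hv0 (by omega) h5
      convert h6 using 1
      rw [Multiset.replicate_succ]
      simp only [← Multiset.singleton_add]
      abel
    · exact absurd hv0 hv
    · by_cases hva : v = a
      · subst hva
        have hBr : (B : ℤ) + r = a * r := by
          obtain ⟨y, hy⟩ := hdv _ rfl (dvd_refl _)
          rw [hy] at h3' h4'
          have y1 : (r : ℤ) ≤ y := le_of_mul_le_mul_left h3' (by omega)
          have y2 : y < (r : ℤ) + 1 := lt_of_mul_lt_mul_left h4' (by omega)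
          have : y = r := by omega
          rw [hy, this]
        rcases Nat.eq_zero_or_pos r with hr | hr
        · subst hr
          have hB : B = 0 := by simpa using hBr
          subst hB
          have hA : A = 1 := by
            have : (a : ℤ) * (A - 1) = 0 := by push_cast at hs; linarith
            rcases mul_eq_zero.mp this with h | h <;> omega
          subst hA
          simpa using Good_base (K := K) (a : ℤ)
        · obtain ⟨r, rfl⟩ : ∃ r', r = r' + 1 := ⟨r - 1, by omega⟩
          push_cast at hs h3' h4' hBr hk1
          have h5 := ih B A r (a + (b - k * a)) (by omega) (by linarith) (by
            have := hj (k - 1)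
            push_cast [hk0] at this
            intro h; apply this; linarith) (by nlinarith) (by nlinarith)
            (by
              have : (a : ℤ) * r ≤ B + r := by linarith
              exact_mod_cast this)
            (by
              have : (B : ℤ) + r < a * (r + 1) := by linarith
              exact_mod_cast this)
          have h6 := Good_split (a : ℤ) (b - k * a) _ (hne B A r) (by rw [hsm]; linarith) (by omega) (by linarith)
            (by
              have := hj (k - 1)
              push_cast [hk0] at this
              intro h; apply this; linarith) h5
          convert h6 using 1
          rw [Multiset.replicate_succ]
          simp only [← Multiset.singleton_add]
          abel
      · have hA : 1 ≤ A := by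
          by_contra h
          have h0 : A = 0 := by omega
          subst h0
          push_cast at hs
          rcases Nat.eq_zero_or_pos r with hr | hr
          · subst hr
            push_cast at hs
            nlinarith
          · have e1 : (b : ℤ) * ((a - 1) * r) ≤ b * B := mul_le_mul_of_nonneg_left (by linarith) (by omega)
            have e2 : ((b : ℤ) * a - k * a) * r < 0 := by nlinarith
            have e3 : 0 ≤ (b : ℤ) * a - k * a := by
              have : (k : ℤ) ≤ b := by exact_mod_cast hkb
              nlinarith
            have e4 : (0 : ℤ) ≤ r := by omega
            nlinarith
        obtain ⟨A, rfl⟩ : ∃ A', A = A' + 1 := ⟨A - 1, by omega⟩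
        push_cast at hs
        have h5 := ih B A r (v + -a) (by omega) (by linarith) (by omega) (by omega) (by omega) h3 h4
        have h6 := Good_split v (-(a : ℤ)) _ (hne B A r) (by rw [hsm]; linarith) hv0 (by omega) (by omega) h5
        convert h6 using 1
        rw [Multiset.replicate_succ]
        simp only [← Multiset.singleton_add]
        abel

lemma good_ab (a b d : ℕ) (ha : 2 ≤ a) (hab : a < b) (hco : Nat.Coprime a b) (hd : 1 ≤ d) :
    Good K (Multiset.replicate (d * a) (b : ℤ) + Multiset.replicate (d * b) (-(a : ℤ))) := by
  have hj : ∀ j : ℕ, (b : ℤ) - j * a ≠ 0 := by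
    intro j h
    have h1 : b = j * a := by
      have : (b : ℤ) = j * a := by linarith
      exact_mod_cast this
    have : a ∣ Nat.gcd a b := Nat.dvd_gcd dvd_rfl ⟨j, by rw [h1, mul_comm]⟩
    rw [hco] at this
    have := Nat.le_of_dvd one_pos this
    omega
  obtain ⟨k, hk1, hk2⟩ : ∃ k : ℕ, ((k : ℤ) - 1) * a < b ∧ (b : ℤ) < k * a := by
    refine ⟨b / a + 1, ?_, ?_⟩
    · have h1 := Nat.div_mul_le_self b a
      have h2 := hj (b / a)
      have h3 : ((b / a : ℕ) : ℤ) * a ≤ b := by exact_mod_cast h1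
      push_cast at h2 h3 ⊢
      have : (b : ℤ) / a * a ≠ b := fun h => h2 (by linarith)
      have := lt_of_le_of_ne h3 this
      linarith
    · have h1 : b < (b / a + 1) * a := by
        rw [mul_comm]; exact Nat.lt_mul_div_succ b (by omega)
      exact_mod_cast h1
  have hkb : k ≤ b := by
    by_contra h
    have : (b : ℤ) ≤ k - 1 := by omega
    nlinarith
  obtain ⟨r, rfl⟩ : ∃ r, d = r + 1 := ⟨d - 1, by omega⟩
  obtain ⟨a', rfl⟩ : ∃ a', a = a' + 1 := ⟨a - 1, by omega⟩
  obtain ⟨c, rfl⟩ := Nat.exists_eq_add_of_le hkb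
  -- B = (r+1) a', A = (r+1)(k+c) - k r = (r+1) c + k
  have h := chain (K := K) (a' + 1) (k + c) k ha hab hco hk1 hk2 hj _ ((r + 1) * a') ((r + 1) * c + k) r
    ((k + c : ℕ) : ℤ) rfl (by push_cast; ring) (by omega) (by omega) le_rfl (by nlinarith) (by nlinarith)
  have h2 := expand_all (K := K) (a' + 1) (k + c) k (by omega) hk1 hj (by omega) r
    (((k + c : ℕ) : ℤ) ::ₘ (Multiset.replicate ((r + 1) * a') ((k + c : ℕ) : ℤ) +
      Multiset.replicate ((r + 1) * c + k) (-((a' + 1 : ℕ) : ℤ))))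
    (by
      intro x hx
      rw [Multiset.mem_cons, Multiset.mem_add] at hx
      rcases hx with rfl | hx | hx
      · omega
      · rw [Multiset.eq_of_mem_replicate hx]; omega
      · rw [Multiset.eq_of_mem_replicate hx]; omega)
    (by
      simp only [Multiset.sum_cons, Multiset.sum_add, Multiset.sum_replicate, nsmul_eq_mul]
      push_cast; ring)
    (by
      convert h using 1
      simp only [← Multiset.singleton_add]
      abel)
  have e1 : (r + 1) * (a' + 1) = r + (1 + (r + 1) * a') := by ring
  have e2 : (r + 1) * (k + c) = r * k + ((r + 1) * c + k) := by ring
  rw [e1, e2, Multiset.replicate_add r, Multiset.replicate_add 1, Multiset.replicate_add (r * k), Multiset.replicate_one]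
  convert h2 using 1
  simp only [← Multiset.singleton_add]
  abel

lemma good_nm (n m : ℕ) (hnm : ¬ n ∣ m) (hmn : ¬ m ∣ n) :
    Good K (Multiset.replicate n (m : ℤ) + Multiset.replicate m (-(n : ℤ))) := by
  have hn : 0 < n := by
    rcases Nat.eq_zero_or_pos n with rfl | h
    · simp at hmn
    · exact h
  obtain ⟨d, a, b, hd, hco, rfl, rfl⟩ : ∃ d a b, 0 < d ∧ Nat.Coprime a b ∧ n = a * d ∧ m = b * d := by
    obtain ⟨a, b, h1, h2, h3⟩ := Nat.exists_coprime n m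
    exact ⟨_, a, b, Nat.gcd_pos_of_pos_left _ hn, h1, h2, h3⟩
  have key : ∀ a b : ℕ, a ≠ 0 → ¬ a * d ∣ b * d → a ≠ 1 ∧ a ≠ 0 := by
    intro a b h0 h
    refine ⟨?_, h0⟩
    rintro rfl
    apply h
    rw [one_mul]; exact dvd_mul_left _ _
  have ha0 : a ≠ 0 := by rintro rfl; simp at hn
  have hb0 : b ≠ 0 := by rintro rfl; simp at hnm
  have ha := key a b ha0 hnm
  have hb := key b a hb0 hmn
  rcases lt_trichotomy a b with h | h | h
  · have := Good_mul (d : ℤ) (good_ab (K := K) a b d (by omega) h hco (by omega))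
    simp only [Multiset.map_add, Multiset.map_replicate] at this
    convert this using 3 <;> (push_cast; ring)
  · subst h
    exact absurd dvd_rfl hnm
  · have := Good_mul (-d : ℤ) (good_ab (K := K) b a d (by omega) h hco.symm (by omega))
    simp only [Multiset.map_add, Multiset.map_replicate] at this
    rw [add_comm]
    convert this using 3 <;> (push_cast; ring)
end chain
end ZZ

namespace ZZ

section final
variable {K : Type*} [Field K] [CharZero K]

lemma core1 (n m R : ℕ) (hn : 2 ≤ n) (hm : 2 ≤ m) (W : Fin R → ℤ)
    (hW : (Finset.univ : Finset (Fin R)).val.map W =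
      Multiset.replicate n (m : ℤ) + Multiset.replicate m (-(n : ℤ)))
    (hg : GoodW K (Fin R) W) :
    ∃ p q : K[X], p.Monic ∧ q.Monic ∧ p.natDegree = n ∧ q.natDegree = m ∧ p.coeff (n - 1) = 0 ∧
      p ^ m - q ^ n ≠ 0 ∧ (p ^ m - q ^ n).natDegree = (m - 1) * (n - 1) := by
  have hR : R = n + m := by
    have := congrArg Multiset.card hW
    simpa using this
  have hval : ∀ i, W i = m ∨ W i = -(n : ℤ) := by
    intro i
    have : W i ∈ (Finset.univ : Finset (Fin R)).val.map W := Multiset.mem_map_of_mem _ (Finset.mem_univ i)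
    rw [hW, Multiset.mem_add] at this
    rcases this with h | h
    · exact Or.inl (Multiset.eq_of_mem_replicate h)
    · exact Or.inr (Multiset.eq_of_mem_replicate h)
  have hw0 : ∀ i, W i ≠ 0 := by
    intro i; rcases hval i with h | h <;> omega
  have hne : (m : ℤ) ≠ -(n : ℤ) := by omega
  set Bl := Finset.univ.filter (fun i => (m : ℤ) = W i) with hBl
  set Wh := Finset.univ.filter (fun i => -(n : ℤ) = W i) with hWh
  have cB : Bl.card = n := by
    have := congrArg (Multiset.count (m : ℤ)) hW
    rw [Multiset.count_map, Multiset.count_add, Multiset.count_replicate_self,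
      Multiset.count_replicate, if_neg hne.symm] at this
    simpa [hBl, Finset.card] using this
  have cW : Wh.card = m := by
    have := congrArg (Multiset.count (-(n : ℤ))) hW
    rw [Multiset.count_map, Multiset.count_add, Multiset.count_replicate_self,
      Multiset.count_replicate, if_neg hne] at this
    simpa [hWh, Finset.card] using this
  have hsum : ∑ i, W i = 0 := by
    have := congrArg Multiset.sum hW
    rw [Multiset.sum_add, Multiset.sum_replicate, Multiset.sum_replicate] at this
    have h2 : ∑ i, W i = n • (m : ℤ) + m • (-(n : ℤ)) := this
    rw [h2]; simp; ring
  obtain ⟨z0, hz0, hp0⟩ := hg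
  rw [Fintype.card_fin] at hp0
  have hn0 : (n : K) ≠ 0 := by exact_mod_cast (by omega : n ≠ 0)
  set t : K := -(∑ i ∈ Bl, z0 i) / n with ht
  set z : Fin R → K := fun i => z0 i + t with hz
  have hzi : Function.Injective z := fun a b h => hz0 (by simpa [hz] using h)
  have hps : ∀ l, l + 2 ≤ R → ∑ i, (W i : K) * z i ^ l = 0 := by
    intro l hl
    rw [hz, ps_shift Finset.univ W z0 t l (fun k hk => hp0 k (by omega))]
    exact hp0 l hl
  have hzs : ∑ i ∈ Bl, z i = 0 := by
    rw [hz, Finset.sum_add_distrib, Finset.sum_const, cB, nsmul_eq_mul, ht]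
    field_simp; ring
  have hp : FF Finset.univ W z = (∏ i ∈ Bl, (X - C (z i))) ^ m := by
    rw [FF, ← Finset.prod_pow, hBl, Finset.prod_filter]
    refine Finset.prod_congr rfl fun i _ => ?_
    rcases hval i with h | h
    · rw [if_pos h.symm, h]; simp
    · rw [if_neg (by rw [h]; exact hne), h]; simp
  have hq : FF Finset.univ (-W) z = (∏ i ∈ Wh, (X - C (z i))) ^ n := by
    rw [FF, ← Finset.prod_pow, hWh, Finset.prod_filter]
    refine Finset.prod_congr rfl fun i _ => ?_
    rcases hval i with h | h
    · rw [if_neg (by rw [h]; exact hne.symm), Pi.neg_apply, h]; simp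
    · rw [if_pos h.symm, Pi.neg_apply, h]; simp
  have hpm : (∏ i ∈ Bl, (X - C (z i))).Monic := monic_prod_of_monic _ _ (fun i _ => monic_X_sub_C _)
  have hqm : (∏ i ∈ Wh, (X - C (z i))).Monic := monic_prod_of_monic _ _ (fun i _ => monic_X_sub_C _)
  have hpd : (∏ i ∈ Bl, (X - C (z i))).natDegree = n := by
    rw [← cB]; exact PP_natDegree Bl z
  have hqd : (∏ i ∈ Wh, (X - C (z i))).natDegree = m := by
    rw [← cW]; exact PP_natDegree Wh z
  refine ⟨_, _, hpm, hqm, hpd, hqd, ?_, ?_⟩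
  · have := prod_X_sub_C_coeff_card_pred Bl z (by omega)
    rw [cB, hzs, neg_zero] at this
    exact this
  rw [← hp, ← hq]
  have hFd : (FF Finset.univ W z).natDegree = n * m := by
    rw [hp, hpm.natDegree_pow, hpd, mul_comm]
  have hGd : (FF Finset.univ (-W) z).natDegree = n * m := by
    rw [hq, hqm.natDegree_pow, hqd]
  have hFm := FF_monic Finset.univ W z
  have hGm := FF_monic Finset.univ (-W) z
  obtain ⟨B, hB⟩ := NN_linear Finset.univ W z (by rw [Finset.card_univ, Fintype.card_fin]; omega)
    (fun l hl => hps l (by rw [Finset.card_univ, Fintype.card_fin] at hl; omega))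
  rw [Finset.card_univ, Fintype.card_fin, hps (R - 2) (by omega), C_0, zero_mul, zero_add] at hB
  have hB0 : B ≠ 0 := by
    have i0 : Fin R := ⟨0, by omega⟩
    have := NN_eval Finset.univ W z (Finset.mem_univ i0)
    rw [hB, eval_C] at this
    rw [this]
    refine mul_ne_zero (by exact_mod_cast hw0 i0) (Finset.prod_ne_zero_iff.2 fun j hj => ?_)
    exact sub_ne_zero.2 fun h => (Finset.ne_of_mem_erase hj) (hzi h).symm
  have hw := wron_FG Finset.univ W hw0 z
  have hDP := DP Finset.univ W hw0 z
  have hDm := DD_monic Finset.univ W z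
  rw [hB] at hw
  have hDd : (DD Finset.univ W z).natDegree + (n + m) = n * m + n * m := by
    have := congrArg natDegree hDP
    rw [hDm.natDegree_mul (PP_monic _ _), hFm.natDegree_mul hGm, hFd, hGd, PP_natDegree,
      Finset.card_univ, Fintype.card_fin] at this
    omega
  set F := FF Finset.univ W z
  set G := FF Finset.univ (-W) z
  have hw' : derivative (F - G) * G - (F - G) * derivative G = C B * DD Finset.univ W z := by
    rw [← hw, derivative_sub]; ring
  have hH0 : F - G ≠ 0 := by
    intro h
    rw [h] at hw'
    simp only [derivative_zero, zero_mul, sub_zero] at hw'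
    exact mul_ne_zero (C_ne_zero.2 hB0) hDm.ne_zero hw'.symm
  refine ⟨hH0, ?_⟩
  have hnm : n + m ≤ n * m := by nlinarith
  have hdl : (F - G).natDegree < G.natDegree := by
    have h1 : (F - G).degree < F.degree := degree_sub_lt (by
      rw [degree_eq_natDegree hFm.ne_zero, degree_eq_natDegree hGm.ne_zero, hFd, hGd]) hFm.ne_zero
      (by rw [hFm.leadingCoeff, hGm.leadingCoeff])
    rw [hGd, ← hFd]
    exact natDegree_lt_natDegree hH0 h1
  obtain ⟨-, h⟩ := wron_deg hH0 hdl
  rw [hw', natDegree_C_mul hB0, hGd] at h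
  obtain ⟨a, rfl⟩ : ∃ a, n = a + 1 := ⟨n - 1, by omega⟩
  obtain ⟨b, rfl⟩ : ∃ b, m = b + 1 := ⟨m - 1, by omega⟩
  simp only [Nat.add_sub_cancel]
  nlinarith

lemma core [IsAlgClosed K] (n m : ℕ) (hnm : ¬ n ∣ m) (hmn : ¬ m ∣ n) (hn : 2 ≤ n) (hm : 2 ≤ m) :
    ∃ p q : K[X], p.Monic ∧ q.Monic ∧ p.natDegree = n ∧ q.natDegree = m ∧ p.coeff (n - 1) = 0 ∧
      p ^ m - q ^ n ≠ 0 ∧ (p ^ m - q ^ n).natDegree = (m - 1) * (n - 1) := by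
  have h := good_nm (K := K) n m hnm hmn
  obtain ⟨a, ha⟩ : ∃ a, n = a + 1 := ⟨n - 1, by omega⟩
  have e : Multiset.replicate n (m : ℤ) + Multiset.replicate m (-(n : ℤ)) =
      (m : ℤ) ::ₘ (Multiset.replicate a (m : ℤ) + Multiset.replicate m (-(n : ℤ))) := by
    conv_lhs => rw [show Multiset.replicate n (m : ℤ) = Multiset.replicate (a + 1) (m : ℤ) by rw [ha]]
    rw [Multiset.replicate_succ, Multiset.cons_add]
  rw [e] at h
  obtain ⟨r, w, hw, hg⟩ := GoodW_of_Good h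
  refine core1 n m (r + 1) hn hm _ ?_ hg
  rw [e, hw, Fin.univ_val_map, List.ofFn_succ]
  simp

lemma final [IsAlgClosed K] (n m : ℕ)
    (hnm : ¬ n ∣ m) (hmn : ¬ m ∣ n) (lam : K) (hlam : lam ≠ 0) :
    ∃ p q : Polynomial K, p.Monic ∧ q.Monic ∧
      p.natDegree = n ∧ q.natDegree = m ∧ p.coeff (n - 1) = 0 ∧
      (p ^ m - q ^ n - Polynomial.C ((n : K) * lam) * Polynomial.X ^ ((m - 1) * (n - 1))).degree <
        (((m - 1) * (n - 1) : ℕ) : WithBot ℕ) := by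
  have hn : 2 ≤ n := by
    rcases n with _ | _ | n
    · simp at hmn
    · simp at hnm
    · omega
  have hm : 2 ≤ m := by
    rcases m with _ | _ | m
    · simp at hnm
    · simp at hmn
    · omega
  obtain ⟨p, q, hp, hq, hpd, hqd, hpc, hH0, hHd⟩ := core (K := K) n m hnm hmn hn hm
  set e := (m - 1) * (n - 1) with he
  have hc : (p ^ m - q ^ n).coeff e ≠ 0 := by
    rw [← hHd]; exact leadingCoeff_ne_zero.2 hH0
  obtain ⟨s, hs⟩ := IsAlgClosed.exists_pow_nat_eq ((n : K) * lam / (p ^ m - q ^ n).coeff e)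
    (n := m + n - 1) (by omega)
  have hee : m * n - e = m + n - 1 := by
    obtain ⟨a, rfl⟩ : ∃ a, n = a + 1 := ⟨n - 1, by omega⟩
    obtain ⟨b, rfl⟩ : ∃ b, m = b + 1 := ⟨m - 1, by omega⟩
    rw [he]; simp only [Nat.add_sub_cancel]
    have : (b + 1) * (a + 1) = b * a + (b + 1 + (a + 1) - 1) := by
      have : b + 1 + (a + 1) - 1 = a + b + 1 := by omega
      rw [this]; ring
    omega
  have hco : ∀ k, (p.scaleRoots s ^ m - q.scaleRoots s ^ n).coeff k =
      (p ^ m - q ^ n).coeff k * s ^ (m * n - k) := by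
    intro k
    rw [← pow_scaleRoots_of_isReduced, ← pow_scaleRoots_of_isReduced, coeff_sub, coeff_scaleRoots,
      coeff_scaleRoots, hp.natDegree_pow, hq.natDegree_pow, hpd, hqd, coeff_sub, mul_comm n m]
    ring
  refine ⟨p.scaleRoots s, q.scaleRoots s, (monic_scaleRoots_iff s).2 hp, (monic_scaleRoots_iff s).2 hq,
    by rw [natDegree_scaleRoots, hpd], by rw [natDegree_scaleRoots, hqd],
    by rw [coeff_scaleRoots, hpc, zero_mul], ?_⟩
  rw [degree_lt_iff_coeff_zero]
  intro k hk
  rw [coeff_sub, hco, coeff_C_mul, coeff_X_pow]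
  rcases Nat.eq_or_lt_of_le hk with h | h
  · subst h
    rw [hee, hs, if_pos rfl]
    field_simp
    ring
  · rw [coeff_eq_zero_of_natDegree_lt (by rw [hHd]; exact h), if_neg (by omega)]
    simp
end final
end ZZ

/-- Let `K` be algebraically closed of characteristic zero and
suppose `m ∤ n` and `n ∤ m`.  Then for every `λ ∈ K^×` there exist monic
`p, q ∈ K[x]` with `deg p = n`, `deg q = m`, the coefficient of `x^{n-1}` in `p`
zero, and `p^m − q^n = nλ x^{mn−m−n+1} +` lower order terms
(`mn−m−n+1 = (m-1)(n-1)`). -/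
theorem statement16 (K : Type*) [Field K] [IsAlgClosed K] [CharZero K] (n m : ℕ)
    (hnm : ¬ n ∣ m) (hmn : ¬ m ∣ n) (lam : K) (hlam : lam ≠ 0) :
    ∃ p q : Polynomial K, p.Monic ∧ q.Monic ∧
      p.natDegree = n ∧ q.natDegree = m ∧ p.coeff (n - 1) = 0 ∧
      (p ^ m - q ^ n - Polynomial.C ((n : K) * lam) * Polynomial.X ^ ((m - 1) * (n - 1))).degree <
        (((m - 1) * (n - 1) : ℕ) : WithBot ℕ) := by
  exact ZZ.final n m hnm hmn lam hlam
end
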